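/- arXiv:1707.00476 — 2 statements merged into one kernel-verified Lean document; each statement's English description precedes it below -/
import Mathlib

section
/- For every ε > 0 there exists d₀ such that for all dimensions d ≥ d₀ the following holds: for every bounded measurable set S ⊆ ℝ^d with vol(S) > 0 and every fugacity λ ≥ 3^{-d/2}, the expected packing density of the hard sphere model satisfies α_S(λ) ≥ (1 − ε) · log(2/√3) · d · 2^{-d}. -/
open MeasureTheory Filter

/-- `rd d` is the radius of a Euclidean ball of volume 1 in `ℝ^d`. -/
noncomputable def rd (d : ℕ) : ℝ :=
  ((volume (Metric.closedBall (0 : EuclideanSpace ℝ (Fin d)) 1)).toReal) ^ (-(1 : ℝ) / d)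

/-- The set of `k`-tuples of points of `S` with pairwise distances `> 2 r_d`,
i.e. centers of packings by balls of volume 1. -/
def packSet (d k : ℕ) (S : Set (EuclideanSpace ℝ (Fin d))) :
    Set (Fin k → EuclideanSpace ℝ (Fin d)) :=
  {x | (∀ i, x i ∈ S) ∧ ∀ i j, i ≠ j → dist (x i) (x j) > 2 * rd d}

/-- The canonical hard sphere partition function `Ẑ_S(k)`. -/
noncomputable def Zhat (d : ℕ) (S : Set (EuclideanSpace ℝ (Fin d))) (k : ℕ) : ℝ :=
  (1 / (Nat.factorial k : ℝ)) *
    ∫ x : Fin k → EuclideanSpace ℝ (Fin d),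
      Set.indicator (packSet d k S) (fun _ => (1 : ℝ)) x

/-- The grand canonical hard sphere partition function `Z_S(λ)`. -/
noncomputable def Zgc (d : ℕ) (S : Set (EuclideanSpace ℝ (Fin d))) (lam : ℝ) : ℝ :=
  ∑' k : ℕ, lam ^ k * Zhat d S k

/-- The expected packing density `α_S(λ)` of the hard sphere model. -/
noncomputable def alphaS (d : ℕ) (S : Set (EuclideanSpace ℝ (Fin d))) (lam : ℝ) : ℝ :=
  (∑' k : ℕ, (k : ℝ) * lam ^ k * Zhat d S k) / ((volume S).toReal * Zgc d S lam)

/-- `Bn d n` is the closed ball of volume `n` centered at the origin in `ℝ^d`. -/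
noncomputable def Bn (d : ℕ) (n : ℝ) : Set (EuclideanSpace ℝ (Fin d)) :=
  Metric.closedBall 0 (n ^ ((1 : ℝ) / d) * rd d)

/-- The maximum number of centers of a packing of `B_n` by balls of volume 1. -/
noncomputable def Md (d : ℕ) (n : ℝ) : ℝ :=
  sSup {m : ℝ | ∃ X : Finset (EuclideanSpace ℝ (Fin d)),
    (∀ x ∈ X, x ∈ Bn d n) ∧ (∀ x ∈ X, ∀ y ∈ X, x ≠ y → dist x y > 2 * rd d) ∧
    m = (X.card : ℝ)}

/-- The externally uncovered region `T(v,X)` for a configuration `X = (x_1,…,x_k)`. -/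
def Treg (d : ℕ) (S : Set (EuclideanSpace ℝ (Fin d))) (v : EuclideanSpace ℝ (Fin d))
    {k : ℕ} (x : Fin k → EuclideanSpace ℝ (Fin d)) : Set (EuclideanSpace ℝ (Fin d)) :=
  {p | p ∈ Metric.closedBall v (2 * rd d) ∩ S ∧
    ∀ i, dist (x i) v > 2 * rd d → dist p (x i) > 2 * rd d}

/-- The expectation of a functional `g(v, X)` under the two-part experiment:
`X` drawn from the hard sphere model on `S` at fugacity `λ`, and independently
`v` uniform in `S`. -/
noncomputable def ExpT (d : ℕ) (S : Set (EuclideanSpace ℝ (Fin d))) (lam : ℝ)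
    (g : EuclideanSpace ℝ (Fin d) → ∀ k : ℕ, (Fin k → EuclideanSpace ℝ (Fin d)) → ℝ) : ℝ :=
  (1 / ((volume S).toReal * Zgc d S lam)) *
    ∑' k : ℕ, (lam ^ k / (Nat.factorial k : ℝ)) *
      ∫ v in S, ∫ x : Fin k → EuclideanSpace ℝ (Fin d),
        Set.indicator (packSet d k S) (fun y => g v k y) x


open scoped ENNReal

namespace HS

/-- `1` if all points of `x` have distance `> R` from `u`. -/
@[irreducible] noncomputable def unc {d : ℕ} (R : ℝ) {k : ℕ} (x : Fin k → EuclideanSpace ℝ (Fin d))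
    (u : EuclideanSpace ℝ (Fin d)) : ℝ≥0∞ := by
  classical exact if ∀ i, R < dist (x i) u then 1 else 0

/-- `1` if `dist u v ≤ R`. -/
@[irreducible] noncomputable def inB {d : ℕ} (R : ℝ) (v u : EuclideanSpace ℝ (Fin d)) : ℝ≥0∞ := by
  classical exact if dist u v ≤ R then 1 else 0

/-- `1` if `u` is in the externally uncovered region. -/
@[irreducible] noncomputable def tI {d : ℕ} (R : ℝ) (v : EuclideanSpace ℝ (Fin d)) {k : ℕ}
    (x : Fin k → EuclideanSpace ℝ (Fin d)) (u : EuclideanSpace ℝ (Fin d)) : ℝ≥0∞ := by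
  classical exact if dist u v ≤ R ∧ ∀ i, R < dist (x i) v → R < dist (x i) u then 1 else 0

/-- Number of points in the ball. -/
@[irreducible] noncomputable def nB {d : ℕ} (R : ℝ) (v : EuclideanSpace ℝ (Fin d)) {k : ℕ}
    (x : Fin k → EuclideanSpace ℝ (Fin d)) : ℕ := by
  classical exact ∑ i, if dist (x i) v ≤ R then 1 else 0

/-- indicator of the packing set -/
@[irreducible] noncomputable def pI {d : ℕ} (S : Set (EuclideanSpace ℝ (Fin d))) {k : ℕ}
    (x : Fin k → EuclideanSpace ℝ (Fin d)) : ℝ≥0∞ := (packSet d k S).indicator (fun _ => 1) x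

/-- Unnormalised expectation. -/
@[irreducible] noncomputable def M {d : ℕ} (S : Set (EuclideanSpace ℝ (Fin d))) (l : ℝ≥0∞)
    (F : ∀ k : ℕ, (Fin k → EuclideanSpace ℝ (Fin d)) → ℝ≥0∞) : ℝ≥0∞ :=
  ∑' k : ℕ, l ^ k / (Nat.factorial k : ℝ≥0∞) * ∫⁻ x, pI S x * F k x

variable {d : ℕ} {S : Set (EuclideanSpace ℝ (Fin d))} {l : ℝ≥0∞} {R : ℝ}

lemma meas_unc (k : ℕ) : Measurable (fun p : (Fin k → EuclideanSpace ℝ (Fin d)) ×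
    EuclideanSpace ℝ (Fin d) => unc R p.1 p.2) := by
  classical
  unfold unc
  refine Measurable.ite ?_ measurable_const measurable_const
  simp only [Set.ofPred_forall]
  refine MeasurableSet.iInter fun i => ?_
  exact measurableSet_lt measurable_const (by fun_prop)

lemma meas_unc' {k : ℕ} (x : Fin k → EuclideanSpace ℝ (Fin d)) :
    Measurable (fun u : EuclideanSpace ℝ (Fin d) => unc R x u) :=
  (meas_unc (d := d) (R := R) k).of_uncurry_left (f := fun x u => unc R x u) (x := x)

lemma meas_inB : Measurable (fun p : EuclideanSpace ℝ (Fin d) ×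
    EuclideanSpace ℝ (Fin d) => inB R p.1 p.2) := by
  classical
  unfold inB
  refine Measurable.ite ?_ measurable_const measurable_const
  exact measurableSet_le (by fun_prop) measurable_const

lemma meas_tI (k : ℕ) : Measurable (fun p : (EuclideanSpace ℝ (Fin d) ×
    (Fin k → EuclideanSpace ℝ (Fin d))) × EuclideanSpace ℝ (Fin d) => tI R p.1.1 p.1.2 p.2) := by
  classical
  unfold tI
  refine Measurable.ite ?_ measurable_const measurable_const
  have e : {a : (EuclideanSpace ℝ (Fin d) × (Fin k → EuclideanSpace ℝ (Fin d))) ×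
      EuclideanSpace ℝ (Fin d) | dist a.2 a.1.1 ≤ R ∧
        ∀ i, R < dist (a.1.2 i) a.1.1 → R < dist (a.1.2 i) a.2}
      = {a | dist a.2 a.1.1 ≤ R} ∩
        {a | ∀ i, R < dist (a.1.2 i) a.1.1 → R < dist (a.1.2 i) a.2} := rfl
  rw [e]
  refine MeasurableSet.inter (measurableSet_le (by fun_prop) measurable_const) ?_
  simp only [Set.ofPred_forall]
  refine MeasurableSet.iInter fun i => ?_
  have : {a : (EuclideanSpace ℝ (Fin d) × (Fin k → EuclideanSpace ℝ (Fin d))) ×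
      EuclideanSpace ℝ (Fin d) | R < dist (a.1.2 i) a.1.1 → R < dist (a.1.2 i) a.2}
      = {a | R < dist (a.1.2 i) a.1.1}ᶜ ∪ {a | R < dist (a.1.2 i) a.2} := by
    ext a; simp [imp_iff_not_or]
  rw [this]
  exact (measurableSet_lt measurable_const (by fun_prop)).compl.union
    (measurableSet_lt measurable_const (by fun_prop))

lemma meas_nB (k : ℕ) : Measurable (fun p : EuclideanSpace ℝ (Fin d) ×
    (Fin k → EuclideanSpace ℝ (Fin d)) => nB R p.1 p.2) := by
  classical
  unfold nB
  refine Finset.measurable_sum _ fun i _ => ?_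
  refine Measurable.ite ?_ measurable_const measurable_const
  exact measurableSet_le (by fun_prop) measurable_const

lemma meas_packSet (hS : MeasurableSet S) (k : ℕ) : MeasurableSet (packSet d k S) := by
  have : packSet d k S = (⋂ i, (fun x => x i) ⁻¹' S) ∩
      ⋂ i, ⋂ j, ⋂ (_ : i ≠ j), {x | 2 * rd d < dist (x i) (x j)} := by
    ext x; simp [packSet]
  rw [this]
  refine MeasurableSet.inter (MeasurableSet.iInter fun i => measurable_pi_apply i hS) ?_
  refine MeasurableSet.iInter fun i => MeasurableSet.iInter fun j => MeasurableSet.iInter fun _ => ?_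
  exact measurableSet_lt measurable_const (by fun_prop)

lemma meas_pI (hS : MeasurableSet S) (k : ℕ) :
    Measurable (fun x : Fin k → EuclideanSpace ℝ (Fin d) => pI S x) :=
  by unfold pI; exact measurable_const.indicator (meas_packSet hS k)

lemma pI_insertNth {k : ℕ} (i : Fin (k+1)) (u : EuclideanSpace ℝ (Fin d))
    (x : Fin k → EuclideanSpace ℝ (Fin d)) :
    pI S (i.insertNth u x : Fin (k+1) → EuclideanSpace ℝ (Fin d)) =
      S.indicator (fun u => pI S x * unc (2 * rd d) x u) u := by
  classical
  have key : (i.insertNth u x : Fin (k+1) → EuclideanSpace ℝ (Fin d)) ∈ packSet d (k+1) S ↔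
      u ∈ S ∧ x ∈ packSet d k S ∧ ∀ j, 2 * rd d < dist (x j) u := by
    simp only [packSet, Set.mem_ofPred_eq, Fin.forall_iff_succAbove i, Fin.insertNth_apply_same,
      Fin.insertNth_apply_succAbove, ne_eq, not_true_eq_false, false_imp_iff, true_and,
      Fin.succAbove_right_inj, gt_iff_lt, Fin.succAbove_ne, Fin.ne_succAbove, not_false_eq_true,
      forall_const, forall_and]
    constructor
    · rintro ⟨⟨h1, h2⟩, h4, h3, h5⟩
      exact ⟨h1, ⟨h2, h5⟩, h4⟩
    · rintro ⟨h1, ⟨h2, h5⟩, h4⟩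
      exact ⟨⟨h1, h2⟩, h4, fun j => by rw [dist_comm]; exact h4 j, h5⟩
  by_cases h1 : u ∈ S <;> by_cases h2 : x ∈ packSet d k S <;>
    by_cases h3 : ∀ j, 2 * rd d < dist (x j) u <;>
    simp [pI, unc, Set.indicator, key, h1, h2, h3]

lemma lint_insert {E : Type*} [MeasureSpace E] [SigmaFinite (volume : Measure E)] {k : ℕ}
    (i : Fin (k+1)) (f : (Fin (k+1) → E) → ℝ≥0∞) (hf : Measurable f) :
    ∫⁻ x, f x = ∫⁻ x : Fin k → E, ∫⁻ u : E, f (i.insertNth u x : Fin (k+1) → E) := by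
  have hmp := (volume_preserving_piFinSuccAbove (fun _ : Fin (k+1) => E) i).symm
  rw [← hmp.lintegral_comp_emb (MeasurableEquiv.measurableEmbedding _), Measure.volume_eq_prod]
  exact lintegral_prod_symm' _ (hf.comp (MeasurableEquiv.measurable _))

lemma meas_removeNth {E : Type*} [MeasurableSpace E] {k : ℕ} (i : Fin (k+1)) :
    Measurable (fun x : Fin (k+1) → E => (i.removeNth x : Fin k → E)) :=
  measurable_pi_lambda _ fun _ => measurable_pi_apply _

lemma meas_summand (hS : MeasurableSet S) {k : ℕ}
    (g : EuclideanSpace ℝ (Fin d) → (Fin k → EuclideanSpace ℝ (Fin d)) → ℝ≥0∞)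
    (hg : Measurable (Function.uncurry g)) (i : Fin (k+1)) :
    Measurable fun x : Fin (k+1) → EuclideanSpace ℝ (Fin d) =>
      pI S x * g (x i) (i.removeNth x) := by
  have h2 : Measurable fun x : Fin (k+1) → EuclideanSpace ℝ (Fin d) =>
      (x i, (i.removeNth x : Fin k → EuclideanSpace ℝ (Fin d))) :=
    (measurable_pi_apply i).prodMk (meas_removeNth i)
  have h3 : Measurable fun x : Fin (k+1) → EuclideanSpace ℝ (Fin d) =>
      g (x i) (i.removeNth x) := hg.comp h2
  exact (meas_pI hS _).mul h3

/-- One-step integration. -/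
lemma lint_succ (hS : MeasurableSet S) {k : ℕ}
    (g : EuclideanSpace ℝ (Fin d) → (Fin k → EuclideanSpace ℝ (Fin d)) → ℝ≥0∞)
    (hg : Measurable (Function.uncurry g)) (i : Fin (k+1)) :
    ∫⁻ x : Fin (k+1) → EuclideanSpace ℝ (Fin d), pI S x * g (x i) (i.removeNth x) =
      ∫⁻ x : Fin k → EuclideanSpace ℝ (Fin d), pI S x *
        ∫⁻ u in S, unc (2 * rd d) x u * g u x := by
  refine (lint_insert i _ (meas_summand hS g hg i)).trans ?_
  refine lintegral_congr fun x => ?_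
  have e : ∀ u : EuclideanSpace ℝ (Fin d),
      pI S (i.insertNth u x : Fin (k+1) → EuclideanSpace ℝ (Fin d)) *
        g ((i.insertNth u x : Fin (k+1) → EuclideanSpace ℝ (Fin d)) i)
          (i.removeNth (i.insertNth u x : Fin (k+1) → EuclideanSpace ℝ (Fin d))) =
      S.indicator (fun u => pI S x * unc (2 * rd d) x u) u * g u x := by
    intro u
    rw [pI_insertNth, Fin.insertNth_apply_same, Fin.removeNth_insertNth]
  refine (lintegral_congr e).trans ?_
  have hm1 : Measurable fun u : EuclideanSpace ℝ (Fin d) => unc (2 * rd d) x u := meas_unc' x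
  have hm2 : Measurable fun u : EuclideanSpace ℝ (Fin d) => g u x :=
    hg.comp (measurable_prodMk_right (y := x))
  have hm : Measurable fun u : EuclideanSpace ℝ (Fin d) => unc (2 * rd d) x u * g u x :=
    hm1.mul hm2
  have e1 : pI S x * ∫⁻ u in S, unc (2 * rd d) x u * g u x =
      ∫⁻ u in S, pI S x * (unc (2 * rd d) x u * g u x) :=
    (lintegral_const_mul (μ := volume.restrict S) (pI S x) hm).symm
  have e2 : ∫⁻ u in S, pI S x * (unc (2 * rd d) x u * g u x) =
      ∫⁻ u, S.indicator (fun u => pI S x * (unc (2 * rd d) x u * g u x)) u :=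
    (lintegral_indicator hS _).symm
  refine Eq.trans ?_ (e1.trans e2).symm
  refine lintegral_congr fun u => ?_
  by_cases h : u ∈ S
  · rw [Set.indicator_of_mem h, Set.indicator_of_mem h, mul_assoc]
  · rw [Set.indicator_of_notMem h, Set.indicator_of_notMem h, zero_mul]

lemma M_gnz (hS : MeasurableSet S)
    (F : ∀ k : ℕ, (Fin k → EuclideanSpace ℝ (Fin d)) → ℝ≥0∞)
    (g : ∀ k : ℕ, EuclideanSpace ℝ (Fin d) → (Fin k → EuclideanSpace ℝ (Fin d)) → ℝ≥0∞)
    (hg : ∀ k, Measurable (Function.uncurry (g k)))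
    (h0 : ∀ x, F 0 x = 0)
    (h1 : ∀ k x, F (k+1) x = ∑ i, g k (x i) (i.removeNth x)) :
    M S l F = l * M S l (fun k x => ∫⁻ u in S, unc (2 * rd d) x u * g k u x) := by
  have step : ∀ k, l ^ (k+1) / ((k+1).factorial : ℝ≥0∞) *
      ∫⁻ x : Fin (k+1) → EuclideanSpace ℝ (Fin d), pI S x * F (k+1) x =
      l * (l ^ k / (k.factorial : ℝ≥0∞) * ∫⁻ x : Fin k → EuclideanSpace ℝ (Fin d), pI S x *
        ∫⁻ u in S, unc (2 * rd d) x u * g k u x) := by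
    intro k
    have e : ∫⁻ x : Fin (k+1) → EuclideanSpace ℝ (Fin d), pI S x * F (k+1) x =
        ((k+1 : ℕ) : ℝ≥0∞) * ∫⁻ x : Fin k → EuclideanSpace ℝ (Fin d), pI S x *
          ∫⁻ u in S, unc (2 * rd d) x u * g k u x := by
      calc _ = ∫⁻ x : Fin (k+1) → EuclideanSpace ℝ (Fin d),
            ∑ i, pI S x * g k (x i) (i.removeNth x) :=
            lintegral_congr fun x => by rw [h1, Finset.mul_sum]
        _ = ∑ i, ∫⁻ x : Fin (k+1) → EuclideanSpace ℝ (Fin d),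
            pI S x * g k (x i) (i.removeNth x) :=
            lintegral_finsetSum' _ fun i _ => (meas_summand hS _ (hg k) i).aemeasurable
        _ = _ := by
            rw [Finset.sum_congr rfl fun i _ => lint_succ hS _ (hg k) i,
              Finset.sum_const, Finset.card_univ, Fintype.card_fin, nsmul_eq_mul]
    rw [e]
    generalize ∫⁻ x : Fin k → EuclideanSpace ℝ (Fin d), pI S x *
          ∫⁻ u in S, unc (2 * rd d) x u * g k u x = I
    rw [Nat.factorial_succ, pow_succ, ENNReal.div_eq_inv_mul, ENNReal.div_eq_inv_mul,
      Nat.cast_mul, ENNReal.mul_inv (by left; simp) (by left; simp)]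
    have : ((k + 1 : ℕ) : ℝ≥0∞)⁻¹ * ((k+1 : ℕ) : ℝ≥0∞) = 1 :=
      ENNReal.inv_mul_cancel (by simp) (ENNReal.natCast_ne_top _)
    calc _ = (((k + 1 : ℕ) : ℝ≥0∞)⁻¹ * ((k+1 : ℕ) : ℝ≥0∞)) *
          (l * ((k.factorial : ℝ≥0∞)⁻¹ * l ^ k * I)) := by ring
      _ = _ := by rw [this, one_mul]
  have z : l ^ 0 / (Nat.factorial 0 : ℝ≥0∞) *
      ∫⁻ x : Fin 0 → EuclideanSpace ℝ (Fin d), pI S x * F 0 x = 0 := by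
    simp [h0]
  unfold M
  rw [← ENNReal.tsum_mul_left, ← tsum_congr step]
  refine (tsum_eq_zero_add' ENNReal.summable
    (f := fun k => l ^ k / (Nat.factorial k : ℝ≥0∞) * ∫⁻ x, pI S x * F k x)).trans ?_
  rw [z, zero_add]

lemma M_mono {F G : ∀ k : ℕ, (Fin k → EuclideanSpace ℝ (Fin d)) → ℝ≥0∞}
    (h : ∀ k x, F k x ≤ G k x) : M S l F ≤ M S l G := by
  unfold M
  gcongr with k x
  exact h k x

lemma M_add (hS : MeasurableSet S) {F G : ∀ k : ℕ, (Fin k → EuclideanSpace ℝ (Fin d)) → ℝ≥0∞}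
    (h : ∀ k, Measurable (F k)) :
    M S l (fun k x => F k x + G k x) = M S l F + M S l G := by
  unfold M
  rw [← ENNReal.tsum_add]
  refine tsum_congr fun k => ?_
  have hm : Measurable fun x => pI S x * F k x := (meas_pI hS k).mul (h k)
  rw [← mul_add, ← lintegral_add_left hm]
  simp only [mul_add]

lemma M_const_mul (hS : MeasurableSet S) (c : ℝ≥0∞)
    {F : ∀ k : ℕ, (Fin k → EuclideanSpace ℝ (Fin d)) → ℝ≥0∞}
    (h : ∀ k, Measurable (F k)) :
    M S l (fun k x => c * F k x) = c * M S l F := by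
  unfold M
  rw [← ENNReal.tsum_mul_left]
  refine tsum_congr fun k => ?_
  have hm : Measurable fun x => pI S x * F k x := (meas_pI hS k).mul (h k)
  rw [mul_left_comm c, ← lintegral_const_mul _ hm]
  congr 1
  refine lintegral_congr fun x => ?_
  ring

lemma M_tsum (hS : MeasurableSet S)
    {F : ℕ → ∀ k : ℕ, (Fin k → EuclideanSpace ℝ (Fin d)) → ℝ≥0∞}
    (h : ∀ n k, Measurable (F n k)) :
    M S l (fun k x => ∑' n, F n k x) = ∑' n, M S l (F n) := by
  unfold M
  rw [ENNReal.tsum_comm]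
  refine tsum_congr fun k => ?_
  have hm : ∀ n, Measurable fun x => pI S x * F n k x := fun n => (meas_pI hS k).mul (h n k)
  rw [ENNReal.tsum_mul_left, ← lintegral_tsum fun n => (hm n).aemeasurable]
  simp only [ENNReal.tsum_mul_left]

lemma M_lint (hS : MeasurableSet S)
    {F : EuclideanSpace ℝ (Fin d) → ∀ k : ℕ, (Fin k → EuclideanSpace ℝ (Fin d)) → ℝ≥0∞}
    (h : ∀ k, Measurable (fun p : EuclideanSpace ℝ (Fin d) ×
      (Fin k → EuclideanSpace ℝ (Fin d)) => F p.1 k p.2)) :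
    ∫⁻ v in S, M S l (F v) = M S l (fun k x => ∫⁻ v in S, F v k x) := by
  unfold M
  have m1 : ∀ k, Measurable (fun p : EuclideanSpace ℝ (Fin d) ×
      (Fin k → EuclideanSpace ℝ (Fin d)) => pI S p.2 * F p.1 k p.2) := fun k =>
    ((meas_pI hS k).comp measurable_snd).mul (h k)
  rw [lintegral_tsum fun k => ((m1 k).lintegral_prod_right'.const_mul _).aemeasurable]
  refine tsum_congr fun k => ?_
  rw [lintegral_const_mul _ (m1 k).lintegral_prod_right', lintegral_lintegral_swap (m1 k).aemeasurable]
  congr 1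
  refine lintegral_congr fun x => ?_
  have hm : Measurable fun v => F v k x := (h k).comp measurable_prodMk_right
  exact lintegral_const_mul (μ := volume.restrict S) (pI S x) hm

/-- Volume of the externally uncovered region. -/
@[irreducible] noncomputable def TV {d : ℕ} (S : Set (EuclideanSpace ℝ (Fin d)))
    (v : EuclideanSpace ℝ (Fin d)) {k : ℕ} (x : Fin k → EuclideanSpace ℝ (Fin d)) : ℝ≥0∞ :=
  ∫⁻ u in S, tI (2 * rd d) v x u

lemma meas_TV (k : ℕ) : Measurable (fun p : EuclideanSpace ℝ (Fin d) ×
    (Fin k → EuclideanSpace ℝ (Fin d)) => TV S p.1 p.2) := by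
  unfold TV
  exact (meas_tI (d := d) (R := 2 * rd d) k).lintegral_prod_right'

lemma meas_TV' (v : EuclideanSpace ℝ (Fin d)) (k : ℕ) :
    Measurable (fun x : Fin k → EuclideanSpace ℝ (Fin d) => TV S v x) :=
  (meas_TV (d := d) (S := S) k).of_uncurry_left (f := fun v x => TV S v x) (x := v)

lemma meas_nB' (v : EuclideanSpace ℝ (Fin d)) (k : ℕ) :
    Measurable (fun x : Fin k → EuclideanSpace ℝ (Fin d) => nB R v x) :=
  (meas_nB (d := d) (R := R) k).of_uncurry_left (f := fun v x => nB R v x) (x := v)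

lemma meas_inB' (v : EuclideanSpace ℝ (Fin d)) :
    Measurable (fun u : EuclideanSpace ℝ (Fin d) => inB R v u) :=
  (meas_inB (d := d) (R := R)).of_uncurry_left (f := fun v x => inB R v x) (x := v)

lemma meas_tI' (v : EuclideanSpace ℝ (Fin d)) {k : ℕ} (x : Fin k → EuclideanSpace ℝ (Fin d)) :
    Measurable (fun u : EuclideanSpace ℝ (Fin d) => tI R v x u) :=
  (meas_tI (d := d) (R := R) k).of_uncurry_left (f := fun p u => tI R p.1 p.2 u) (x := (v, x))

lemma nB_cast {k : ℕ} (v : EuclideanSpace ℝ (Fin d)) (x : Fin k → EuclideanSpace ℝ (Fin d)) :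
    ((nB R v x : ℕ) : ℝ≥0∞) = ∑ i, inB R v (x i) := by
  unfold nB inB
  push_cast
  rfl

lemma inB_of_le {v u : EuclideanSpace ℝ (Fin d)} (h : dist u v ≤ R) : inB R v u = 1 := by
  unfold inB; simp [h]

lemma inB_of_lt {v u : EuclideanSpace ℝ (Fin d)} (h : R < dist u v) : inB R v u = 0 := by
  unfold inB; simp [h]

lemma nB_remove {k : ℕ} (v : EuclideanSpace ℝ (Fin d))
    (x : Fin (k+1) → EuclideanSpace ℝ (Fin d)) (i : Fin (k+1)) (h : dist (x i) v ≤ R) :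
    nB R v x = nB R v (i.removeNth x : Fin k → EuclideanSpace ℝ (Fin d)) + 1 := by
  unfold nB
  rw [Fin.sum_univ_succAbove _ i, add_comm]
  rw [if_pos h]
  rfl

lemma tI_remove {k : ℕ} (v u : EuclideanSpace ℝ (Fin d))
    (x : Fin (k+1) → EuclideanSpace ℝ (Fin d)) (i : Fin (k+1)) (h : dist (x i) v ≤ R) :
    tI R v x u = tI R v (i.removeNth x : Fin k → EuclideanSpace ℝ (Fin d)) u := by
  unfold tI
  simp only [Fin.forall_iff_succAbove i, not_lt.mpr h, false_imp_iff, true_and, Fin.removeNth]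
  congr

lemma TV_remove {k : ℕ} (v : EuclideanSpace ℝ (Fin d))
    (x : Fin (k+1) → EuclideanSpace ℝ (Fin d)) (i : Fin (k+1)) (h : dist (x i) v ≤ 2 * rd d) :
    TV S v x = TV S v (i.removeNth x : Fin k → EuclideanSpace ℝ (Fin d)) := by
  unfold TV
  exact lintegral_congr fun u => tI_remove v u x i h

lemma unc_inB_le {k : ℕ} (v u : EuclideanSpace ℝ (Fin d))
    (x : Fin k → EuclideanSpace ℝ (Fin d)) : unc R x u * inB R v u ≤ tI R v x u := by
  classical
  unfold unc inB tI
  by_cases h1 : ∀ i, R < dist (x i) u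
  · by_cases h2 : dist u v ≤ R <;> simp [h1, h2]
  · simp [h1]

lemma meas_ite (v : EuclideanSpace ℝ (Fin d)) (k n : ℕ) :
    Measurable (fun x : Fin k → EuclideanSpace ℝ (Fin d) =>
      if nB R v x = n then (1 : ℝ≥0∞) else 0) :=
  (measurable_from_top (f := fun m : ℕ => if m = n then (1 : ℝ≥0∞) else 0)).comp (meas_nB' v k)

lemma step1 (hS : MeasurableSet S) (v : EuclideanSpace ℝ (Fin d)) (n : ℕ) :
    ∀ (F : ∀ k : ℕ, (Fin k → EuclideanSpace ℝ (Fin d)) → ℝ≥0∞),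
    (∀ k, Measurable (F k)) →
    (∀ (k : ℕ) (x : Fin (k+1) → EuclideanSpace ℝ (Fin d)) (i : Fin (k+1)),
      dist (x i) v ≤ 2 * rd d → F (k+1) x = F k (i.removeNth x)) →
    (n.factorial : ℝ≥0∞) * M S l (fun k x => F k x * if nB (2 * rd d) v x = n then 1 else 0) ≤
      M S l (fun k x => F k x * (l * TV S v x) ^ n *
        if nB (2 * rd d) v x = 0 then 1 else 0) := by
  induction n with
  | zero => intro F hF _; simp
  | succ n ih =>
    intro F hF hinv
    have hFm : ∀ k m, Measurable (fun x : Fin k → EuclideanSpace ℝ (Fin d) =>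
      F k x * if nB (2 * rd d) v x = m then (1 : ℝ≥0∞) else 0) := fun k m =>
        (hF k).mul (meas_ite v k m)
    have key : ((n + 1 : ℕ) : ℝ≥0∞) *
        M S l (fun k x => F k x * if nB (2 * rd d) v x = n + 1 then 1 else 0) ≤
        M S l (fun k x => (F k x * (l * TV S v x)) * if nB (2 * rd d) v x = n then 1 else 0) := by
      rw [← M_const_mul hS _ (fun k => hFm k (n+1))]
      have hg : ∀ k, Measurable (Function.uncurry
          (fun (u : EuclideanSpace ℝ (Fin d)) (x : Fin k → EuclideanSpace ℝ (Fin d)) =>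
            inB (2 * rd d) v u * (F k x * if nB (2 * rd d) v x = n then (1 : ℝ≥0∞) else 0))) := by
        intro k
        exact ((meas_inB' v).comp measurable_fst).mul ((hFm k n).comp measurable_snd)
      rw [M_gnz hS _ (fun k u x => inB (2 * rd d) v u *
        (F k x * if nB (2 * rd d) v x = n then (1 : ℝ≥0∞) else 0)) hg]
      · rw [← M_const_mul hS]
        · refine M_mono fun k x => ?_
          have e : ∫⁻ u in S, unc (2 * rd d) x u * (inB (2 * rd d) v u *
              (F k x * if nB (2 * rd d) v x = n then (1 : ℝ≥0∞) else 0)) ≤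
              TV S v x * (F k x * if nB (2 * rd d) v x = n then (1 : ℝ≥0∞) else 0) := by
            have e2 : TV S v x * (F k x * if nB (2 * rd d) v x = n then (1 : ℝ≥0∞) else 0) =
              ∫⁻ u in S, tI (2 * rd d) v x u *
                (F k x * if nB (2 * rd d) v x = n then (1 : ℝ≥0∞) else 0) := by
              rw [TV]
              exact (lintegral_mul_const (μ := volume.restrict S) _ (meas_tI' v x)).symm
            rw [e2]
            refine lintegral_mono fun u => ?_
            rw [← mul_assoc]
            exact mul_le_mul_left (unc_inB_le v u x) _
          calc _ ≤ l * (TV S v x * (F k x * if nB (2 * rd d) v x = n then (1 : ℝ≥0∞) else 0)) :=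
                mul_le_mul_right e l
            _ = _ := by ring
        · intro k
          have h1 : Measurable fun p : (Fin k → EuclideanSpace ℝ (Fin d)) ×
              EuclideanSpace ℝ (Fin d) => unc (2 * rd d) p.1 p.2 * (inB (2 * rd d) v p.2 *
              (F k p.1 * if nB (2 * rd d) v p.1 = n then (1 : ℝ≥0∞) else 0)) :=
            (meas_unc k).mul ((hg k).comp measurable_swap)
          exact h1.lintegral_prod_right'
      · intro x
        unfold nB
        simp
      · intro k x
        by_cases h : nB (2 * rd d) v x = n + 1
        · have : ∀ i, inB (2 * rd d) v (x i) * (F k (i.removeNth x) *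
              if nB (2 * rd d) v (i.removeNth x : Fin k → EuclideanSpace ℝ (Fin d)) = n
                then (1 : ℝ≥0∞) else 0) = inB (2 * rd d) v (x i) * F (k+1) x := by
            intro i
            rcases le_or_gt (dist (x i) v) (2 * rd d) with hi | hi
            · have := nB_remove v x i hi
              rw [hinv k x i hi, if_pos (by omega), mul_one]
            · simp [inB_of_lt hi]
          rw [Finset.sum_congr rfl fun i _ => this i, ← Finset.sum_mul, ← nB_cast, h]
          simp
        · rw [if_neg h, mul_zero, mul_zero]
          symm
          refine Finset.sum_eq_zero fun i _ => ?_
          rcases le_or_gt (dist (x i) v) (2 * rd d) with hi | hi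
          · have := nB_remove v x i hi
            rw [if_neg (by omega), mul_zero, mul_zero]
          · simp [inB_of_lt hi]
    calc _ = (n.factorial : ℝ≥0∞) * (((n + 1 : ℕ) : ℝ≥0∞) *
        M S l (fun k x => F k x * if nB (2 * rd d) v x = n + 1 then 1 else 0)) := by
          rw [Nat.factorial_succ, Nat.cast_mul]; ring
      _ ≤ _ := mul_le_mul_right key _
      _ ≤ _ := ih (fun k x => F k x * (l * TV S v x))
          (fun k => (hF k).mul ((meas_TV' v k).const_mul l))
          (fun k x i hi => by rw [hinv k x i hi, TV_remove v x i hi])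
      _ = _ := by
          congr 1; funext k x; ring


lemma tsum_exp (y : ℝ≥0∞) (hy : y ≠ ∞) :
    ∑' n : ℕ, ((n.factorial : ℝ≥0∞))⁻¹ * y ^ n = ENNReal.ofReal (Real.exp y.toReal) := by
  rw [Real.exp_eq_exp_ℝ, NormedSpace.exp_eq_tsum_div,
    ENNReal.ofReal_tsum_of_nonneg (fun n => by positivity)
      (NormedSpace.expSeries_div_summable (𝔸 := ℝ) _)]
  refine tsum_congr fun n => ?_
  rw [ENNReal.ofReal_div_of_pos (by positivity), ENNReal.ofReal_pow ENNReal.toReal_nonneg,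
    ENNReal.ofReal_toReal hy, ENNReal.ofReal_natCast, ENNReal.div_eq_inv_mul]

/-- The damping factor. -/
@[irreducible] noncomputable def eF {d : ℕ} (S : Set (EuclideanSpace ℝ (Fin d))) (l : ℝ≥0∞)
    (v : EuclideanSpace ℝ (Fin d)) {k : ℕ} (x : Fin k → EuclideanSpace ℝ (Fin d)) : ℝ≥0∞ :=
  ENNReal.ofReal (Real.exp (-(l * TV S v x).toReal))

lemma meas_eF (v : EuclideanSpace ℝ (Fin d)) (k : ℕ) :
    Measurable (fun x : Fin k → EuclideanSpace ℝ (Fin d) => eF S l v x) := by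
  unfold eF
  exact (Real.measurable_exp.comp
    (((meas_TV' v k).const_mul l).ennreal_toReal.neg)).ennreal_ofReal

lemma TV_le (v : EuclideanSpace ℝ (Fin d)) {k : ℕ} (x : Fin k → EuclideanSpace ℝ (Fin d)) :
    TV S v x ≤ volume S := by
  unfold TV
  calc _ ≤ ∫⁻ u in S, 1 := by
        refine lintegral_mono fun u => ?_
        unfold tI
        split_ifs <;> simp
    _ = _ := by simp

lemma step1b (hS : MeasurableSet S) (hV : volume S ≠ ∞) (hl : l ≠ ∞)
    (v : EuclideanSpace ℝ (Fin d)) :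
    M S l (fun k x => eF S l v x) ≤
      M S l (fun k x => if nB (2 * rd d) v x = 0 then 1 else 0) := by
  have hY : ∀ (k : ℕ) (x : Fin k → EuclideanSpace ℝ (Fin d)), l * TV S v x ≠ ∞ := fun k x =>
    ENNReal.mul_ne_top hl (ne_top_of_le_ne_top hV (TV_le v x))
  have m1 : ∀ n k, Measurable fun x : Fin k → EuclideanSpace ℝ (Fin d) =>
      eF S l v x * (l * TV S v x) ^ n * if nB (2 * rd d) v x = 0 then (1 : ℝ≥0∞) else 0 :=
    fun n k => ((meas_eF v k).mul (((meas_TV' v k).const_mul l).pow_const n)).mul (meas_ite v k 0)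
  have e1 : M S l (fun k x => eF S l v x) =
      ∑' n, M S l (fun k x => eF S l v x * if nB (2 * rd d) v x = n then 1 else 0) := by
    have m0 : ∀ n k, Measurable fun x : Fin k → EuclideanSpace ℝ (Fin d) =>
        eF S l v x * if nB (2 * rd d) v x = n then (1 : ℝ≥0∞) else 0 :=
      fun n k => (meas_eF v k).mul (meas_ite v k n)
    rw [← M_tsum hS m0]
    congr 1; funext k x
    rw [ENNReal.tsum_mul_left]
    have : (∑' n : ℕ, if nB (2 * rd d) v x = n then (1 : ℝ≥0∞) else 0) = 1 := by
      rw [tsum_eq_single (nB (2 * rd d) v x)]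
      · simp
      · intro n hn; simp [hn.symm]
    rw [this, mul_one]
  rw [e1]
  calc _ ≤ ∑' n : ℕ, M S l (fun k x => ((n.factorial : ℝ≥0∞))⁻¹ *
        (eF S l v x * (l * TV S v x) ^ n * if nB (2 * rd d) v x = 0 then 1 else 0)) := by
        refine ENNReal.tsum_le_tsum fun n => ?_
        rw [M_const_mul hS _ (m1 n)]
        have := step1 (l := l) hS v n (fun k x => eF S l v x) (meas_eF v)
          (fun k x i hi => by unfold eF; rw [TV_remove v x i hi])
        have hn : ((n.factorial : ℝ≥0∞))⁻¹ * (n.factorial : ℝ≥0∞) = 1 :=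
          ENNReal.inv_mul_cancel (by simp [Nat.factorial_ne_zero]) (ENNReal.natCast_ne_top _)
        refine le_trans (le_of_eq ?_) (mul_le_mul_right this _)
        rw [← mul_assoc, hn, one_mul]
    _ = M S l (fun k x => ∑' n : ℕ, ((n.factorial : ℝ≥0∞))⁻¹ *
        (eF S l v x * (l * TV S v x) ^ n * if nB (2 * rd d) v x = 0 then 1 else 0)) :=
        (M_tsum hS fun n k => (m1 n k).const_mul _).symm
    _ ≤ _ := by
        refine M_mono fun k x => le_of_eq ?_
        have : ∀ n : ℕ, ((n.factorial : ℝ≥0∞))⁻¹ *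
          (eF S l v x * (l * TV S v x) ^ n * if nB (2 * rd d) v x = 0 then 1 else 0) =
          (eF S l v x * if nB (2 * rd d) v x = 0 then 1 else 0) *
            (((n.factorial : ℝ≥0∞))⁻¹ * (l * TV S v x) ^ n) := fun n => by ring
        rw [tsum_congr this, ENNReal.tsum_mul_left, tsum_exp _ (hY k x), eF, mul_right_comm,
          ← ENNReal.ofReal_mul (Real.exp_nonneg _), ← Real.exp_add]
        simp

lemma tangent (y : ℝ≥0∞) (hy : y ≠ ∞) (z : ℝ) :
    ENNReal.ofReal (Real.exp (-z) * (1 + z)) ≤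
      ENNReal.ofReal (Real.exp (-y.toReal)) + ENNReal.ofReal (Real.exp (-z)) * y := by
  rw [← ENNReal.ofReal_toReal hy, ENNReal.toReal_ofReal ENNReal.toReal_nonneg,
    ← ENNReal.ofReal_mul (Real.exp_nonneg _),
    ← ENNReal.ofReal_add (Real.exp_nonneg _) (by positivity)]
  refine ENNReal.ofReal_le_ofReal ?_
  have h := Real.add_one_le_exp (z - y.toReal)
  have h2 : Real.exp (-y.toReal) = Real.exp (-z) * Real.exp (z - y.toReal) := by
    rw [← Real.exp_add]; congr 1; ring
  rw [h2]
  nlinarith [Real.exp_pos (-z)]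

lemma step1c (hS : MeasurableSet S) (hV : volume S ≠ ∞) (hl : l ≠ ∞)
    (v : EuclideanSpace ℝ (Fin d)) (z : ℝ) :
    ENNReal.ofReal (Real.exp (-z) * (1 + z)) * M S l (fun _ _ => 1) ≤
      M S l (fun k x => if nB (2 * rd d) v x = 0 then 1 else 0) +
      ENNReal.ofReal (Real.exp (-z)) * M S l (fun k x => l * TV S v x) := by
  rw [← M_const_mul hS _ (fun k => measurable_const),
    ← M_const_mul hS _ (fun k => (meas_TV' v k).const_mul l)]
  refine le_trans ?_ (add_le_add_left (step1b hS hV hl v) _)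
  rw [← M_add hS (meas_eF v)]
  refine M_mono fun k x => ?_
  rw [mul_one, eF]
  exact tangent _ (ENNReal.mul_ne_top hl (ne_top_of_le_ne_top hV (TV_le v x))) z

lemma vol_ball (hd : 1 ≤ d) (x : EuclideanSpace ℝ (Fin d)) (c : ℝ) (hc : 0 ≤ c) :
    volume (Metric.closedBall x (c * rd d)) = ENNReal.ofReal (c ^ d) := by
  have hV : 0 < volume (Metric.closedBall (0 : EuclideanSpace ℝ (Fin d)) 1) :=
    Metric.measure_closedBall_pos _ _ one_pos
  have hV' : volume (Metric.closedBall (0 : EuclideanSpace ℝ (Fin d)) 1) ≠ ∞ :=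
    measure_closedBall_lt_top.ne
  set V := volume (Metric.closedBall (0 : EuclideanSpace ℝ (Fin d)) 1) with hVdef
  have hr : 0 ≤ rd d := by unfold rd; positivity
  have hvp : 0 < V.toReal := ENNReal.toReal_pos hV.ne' hV'
  have hrd : (rd d) ^ d = (V.toReal)⁻¹ := by
    have hd' : (d : ℝ) ≠ 0 := by positivity
    rw [rd, ← Real.rpow_natCast, ← Real.rpow_mul ENNReal.toReal_nonneg, div_mul_cancel₀ _ hd',
      Real.rpow_neg_one]
  rw [Measure.addHaar_closedBall' _ _ (mul_nonneg hc hr), finrank_euclideanSpace_fin, mul_pow,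
    hrd, ← hVdef, ← ENNReal.ofReal_toReal hV', ENNReal.toReal_ofReal hvp.le,
    ← ENNReal.ofReal_mul (by positivity)]
  congr 1
  field_simp

lemma rd_nonneg (d : ℕ) : 0 ≤ rd d := by unfold rd; positivity

lemma lens (hd : 1 ≤ d) (u v : EuclideanSpace ℝ (Fin d)) (h : dist u v ≤ 2 * rd d) :
    volume {w : EuclideanSpace ℝ (Fin d) | dist w u ≤ 2 * rd d ∧ dist w v ≤ dist u v} ≤
      ENNReal.ofReal (Real.sqrt 3 ^ d) := by
  rw [← vol_ball hd (midpoint ℝ u v) (Real.sqrt 3) (Real.sqrt_nonneg _)]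
  refine measure_mono fun w hw => ?_
  obtain ⟨h1, h2⟩ := hw
  rw [Metric.mem_closedBall]
  have hr := rd_nonneg d
  refine abs_le_of_sq_le_sq' ?_ (by positivity) |>.2
  rw [mul_pow, Real.sq_sqrt (by norm_num)]
  have par := parallelogram_law_with_norm ℝ (w - u) (w - v)
  have e1 : (w - u) + (w - v) = (2 : ℝ) • (w - midpoint ℝ u v) := by
    rw [midpoint_eq_smul_add, smul_sub, smul_smul]
    norm_num
    rw [two_smul]; abel
  have e2 : (w - u) - (w - v) = v - u := by abel
  rw [e1, e2, norm_smul, ← dist_eq_norm, ← dist_eq_norm, ← dist_eq_norm, ← dist_eq_norm] at par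
  rw [dist_comm v u] at par
  norm_num at par
  have h3 := dist_nonneg (x := w) (y := u)
  have h4 := dist_nonneg (x := w) (y := v)
  have h5 := dist_nonneg (x := u) (y := v)
  nlinarith [mul_self_le_mul_self h3 h1, mul_self_le_mul_self h4 h2, mul_self_le_mul_self h5 h]

lemma inB_comm (u w : EuclideanSpace ℝ (Fin d)) : inB R u w = inB R w u := by
  unfold inB; rw [dist_comm]

/-- one half of the pair indicator -/
@[irreducible] noncomputable def hI {d : ℕ} (R : ℝ) (v w u : EuclideanSpace ℝ (Fin d)) : ℝ≥0∞ := by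
  classical exact if dist w u ≤ R ∧ dist w v ≤ dist u v then 1 else 0

lemma meas_hI (v : EuclideanSpace ℝ (Fin d)) :
    Measurable (fun p : EuclideanSpace ℝ (Fin d) × EuclideanSpace ℝ (Fin d) =>
      hI R v p.1 p.2) := by
  classical
  unfold hI
  refine Measurable.ite ?_ measurable_const measurable_const
  exact (measurableSet_le (f := fun a : EuclideanSpace ℝ (Fin d) × EuclideanSpace ℝ (Fin d) =>
      dist a.1 a.2) (g := fun _ => R) (by fun_prop) measurable_const).inter
    (measurableSet_le (f := fun a : EuclideanSpace ℝ (Fin d) × EuclideanSpace ℝ (Fin d) =>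
      dist a.1 v) (g := fun a => dist a.2 v) (by fun_prop) (by fun_prop))

lemma inB_le_hI (v w u : EuclideanSpace ℝ (Fin d)) : inB R w u ≤ hI R v w u + hI R v u w := by
  unfold inB hI
  by_cases h : dist u w ≤ R
  · have h' : dist w u ≤ R := by rwa [dist_comm]
    rcases le_total (dist w v) (dist u v) with h2 | h2 <;> simp [h, h', h2]
  · simp [h]

lemma lint_hI (hd : 1 ≤ d) (v u : EuclideanSpace ℝ (Fin d)) (h : dist u v ≤ 2 * rd d) :
    ∫⁻ w in S, hI (2 * rd d) v w u ≤ ENNReal.ofReal (Real.sqrt 3 ^ d) := by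
  classical
  refine le_trans (setLIntegral_le_lintegral _ _) ?_
  refine le_trans (le_of_eq ?_) (lens hd u v h)
  have hm : MeasurableSet
      {w : EuclideanSpace ℝ (Fin d) | dist w u ≤ 2 * rd d ∧ dist w v ≤ dist u v} :=
    (measurableSet_le (f := fun a : EuclideanSpace ℝ (Fin d) =>
      dist a u) (g := fun _ => 2 * rd d) (by fun_prop) measurable_const).inter
    (measurableSet_le (f := fun a : EuclideanSpace ℝ (Fin d) =>
      dist a v) (g := fun _ => dist u v) (by fun_prop) measurable_const)
  rw [← lintegral_indicator_one hm]
  refine lintegral_congr fun w => ?_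
  unfold hI
  simp [Set.indicator]

lemma pair_bound (hd : 1 ≤ d) (v : EuclideanSpace ℝ (Fin d))
    (t : EuclideanSpace ℝ (Fin d) → ℝ≥0∞) (ht : Measurable t) (ht1 : ∀ u, t u ≤ 1)
    (ht0 : ∀ u, 2 * rd d < dist u v → t u = 0) :
    ∫⁻ w in S, t w * ∫⁻ u in S, t u * inB (2 * rd d) w u ≤
      2 * ENNReal.ofReal (Real.sqrt 3 ^ d) * ∫⁻ u in S, t u := by
  have mfst : Measurable fun p : EuclideanSpace ℝ (Fin d) × EuclideanSpace ℝ (Fin d) => t p.1 :=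
    ht.comp measurable_fst
  have msnd : Measurable fun p : EuclideanSpace ℝ (Fin d) × EuclideanSpace ℝ (Fin d) => t p.2 :=
    ht.comp measurable_snd
  have m1 : Measurable fun p : EuclideanSpace ℝ (Fin d) × EuclideanSpace ℝ (Fin d) =>
      t p.1 * t p.2 * hI (2 * rd d) v p.1 p.2 := (mfst.mul msnd).mul (meas_hI v)
  have m2 : Measurable fun p : EuclideanSpace ℝ (Fin d) × EuclideanSpace ℝ (Fin d) =>
      t p.2 * t p.1 * hI (2 * rd d) v p.2 p.1 := m1.comp measurable_swap
  have m1' : ∀ w, Measurable fun u : EuclideanSpace ℝ (Fin d) =>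
      t w * t u * hI (2 * rd d) v w u := fun w =>
    m1.of_uncurry_left (f := fun w u => t w * t u * hI (2 * rd d) v w u) (x := w)
  have swap : ∫⁻ w in S, ∫⁻ u in S, t u * t w * hI (2 * rd d) v u w =
      ∫⁻ w in S, ∫⁻ u in S, t w * t u * hI (2 * rd d) v w u :=
    lintegral_lintegral_swap (μ := volume.restrict S) (ν := volume.restrict S)
      (f := fun w u => t u * t w * hI (2 * rd d) v u w) m2.aemeasurable
  have half : ∫⁻ w in S, ∫⁻ u in S, t u * t w * hI (2 * rd d) v u w ≤
      ENNReal.ofReal (Real.sqrt 3 ^ d) * ∫⁻ u in S, t u := by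
    rw [← lintegral_const_mul _ ht]
    refine lintegral_mono fun w => ?_
    calc ∫⁻ u in S, t u * t w * hI (2 * rd d) v u w
        ≤ ∫⁻ u in S, t w * hI (2 * rd d) v u w := by
          refine lintegral_mono fun u => ?_
          have := ht1 u
          calc t u * t w * hI (2 * rd d) v u w ≤ 1 * t w * hI (2 * rd d) v u w := by gcongr
            _ = _ := by rw [one_mul]
      _ = t w * ∫⁻ u in S, hI (2 * rd d) v u w := by
          refine lintegral_const_mul (μ := volume.restrict S) _ ?_
          exact (meas_hI (R := 2 * rd d) v).of_uncurry_right
            (f := fun w u => hI (2 * rd d) v w u) (y := w)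
      _ ≤ _ := by
          rcases le_or_gt (dist w v) (2 * rd d) with h | h
          · rw [mul_comm]
            exact mul_le_mul_left (lint_hI hd v w h) _
          · simp [ht0 w h]
  calc ∫⁻ w in S, t w * ∫⁻ u in S, t u * inB (2 * rd d) w u
      ≤ ∫⁻ w in S, ((∫⁻ u in S, t w * t u * hI (2 * rd d) v w u) +
        ∫⁻ u in S, t u * t w * hI (2 * rd d) v u w) := by
        refine lintegral_mono fun w => ?_
        have mi : Measurable fun u => t u * inB (2 * rd d) w u := ht.mul (meas_inB' w)
        have e : t w * ∫⁻ u in S, t u * inB (2 * rd d) w u =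
          ∫⁻ u in S, t w * (t u * inB (2 * rd d) w u) :=
          (lintegral_const_mul (μ := volume.restrict S) _ mi).symm
        have e2 : (∫⁻ u in S, t w * t u * hI (2 * rd d) v w u) +
            ∫⁻ u in S, t u * t w * hI (2 * rd d) v u w =
            ∫⁻ u in S, (t w * t u * hI (2 * rd d) v w u + t u * t w * hI (2 * rd d) v u w) :=
          (lintegral_add_left (μ := volume.restrict S) (m1' w) _).symm
        refine le_trans (le_of_eq e) (le_trans ?_ (le_of_eq e2.symm))
        refine lintegral_mono fun u => ?_
        calc t w * (t u * inB (2 * rd d) w u)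
            ≤ t w * (t u * (hI (2 * rd d) v w u + hI (2 * rd d) v u w)) := by
              gcongr
              exact inB_le_hI v w u
          _ = _ := by ring
    _ = (∫⁻ w in S, ∫⁻ u in S, t w * t u * hI (2 * rd d) v w u) +
        ∫⁻ w in S, ∫⁻ u in S, t u * t w * hI (2 * rd d) v u w :=
        lintegral_add_left (μ := volume.restrict S) m1.lintegral_prod_right' _
    _ ≤ ENNReal.ofReal (Real.sqrt 3 ^ d) * (∫⁻ u in S, t u) +
        ENNReal.ofReal (Real.sqrt 3 ^ d) * ∫⁻ u in S, t u := by
        rw [← swap]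
        exact add_le_add half half
    _ = _ := by ring

lemma tI_le_one {k : ℕ} (v u : EuclideanSpace ℝ (Fin d))
    (x : Fin k → EuclideanSpace ℝ (Fin d)) : tI R v x u ≤ 1 := by
  unfold tI; split_ifs <;> simp

lemma tI_zero {k : ℕ} (v u : EuclideanSpace ℝ (Fin d))
    (x : Fin k → EuclideanSpace ℝ (Fin d)) (h : R < dist u v) : tI R v x u = 0 := by
  unfold tI; simp [h]

lemma tI_le {k : ℕ} (v u : EuclideanSpace ℝ (Fin d))
    (x : Fin k → EuclideanSpace ℝ (Fin d)) :
    tI R v x u ≤ unc R x u * inB R v u + tI R v x u * ∑ i, inB R v (x i) * inB R (x i) u := by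
  classical
  by_cases h : dist u v ≤ R ∧ ∀ i, R < dist (x i) v → R < dist (x i) u
  · by_cases h2 : ∀ i, R < dist (x i) u
    · refine le_trans (tI_le_one v u x) (le_trans ?_ le_self_add)
      rw [inB_of_le h.1]; unfold unc; simp [h2]
    · push Not at h2
      obtain ⟨i, hi⟩ := h2
      refine le_trans ?_ le_add_self
      have h3 : dist (x i) v ≤ R := by
        by_contra h4
        exact absurd (h.2 i (not_le.mp h4)) (not_lt.mpr hi)
      have : (1 : ℝ≥0∞) ≤ ∑ i, inB R v (x i) * inB R (x i) u := by
        refine le_trans ?_ (Finset.single_le_sum (f := fun i => inB R v (x i) * inB R (x i) u)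
          (fun _ _ => zero_le) (Finset.mem_univ i))
        rw [inB_of_le h3, inB_of_le (by rwa [dist_comm]), one_mul]
      calc tI R v x u = tI R v x u * 1 := (mul_one _).symm
        _ ≤ _ := mul_le_mul_right this _
  · have : tI R v x u = 0 := by unfold tI; simp only [h, if_false]
    rw [this]; exact zero_le

lemma step2 (hd : 1 ≤ d) (hS : MeasurableSet S) (v : EuclideanSpace ℝ (Fin d)) :
    M S l (fun _ x => l * TV S v x) ≤ M S l (fun _ x => ((nB (2 * rd d) v x : ℕ) : ℝ≥0∞)) +
      l * (2 * ENNReal.ofReal (Real.sqrt 3 ^ d)) * M S l (fun _ x => l * TV S v x) := by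
  have muB : ∀ k, Measurable fun p : (Fin k → EuclideanSpace ℝ (Fin d)) ×
      EuclideanSpace ℝ (Fin d) => unc (2 * rd d) p.1 p.2 * inB (2 * rd d) v p.2 := fun k =>
    (meas_unc k).mul ((meas_inB' v).comp measurable_snd)
  have e1 : M S l (fun _ x => ((nB (2 * rd d) v x : ℕ) : ℝ≥0∞)) =
      l * M S l (fun k x => ∫⁻ u in S, unc (2 * rd d) x u * inB (2 * rd d) v u) := by
    refine M_gnz hS _ (fun _ u _ => inB (2 * rd d) v u) ?_ ?_ ?_
    · intro k; exact (meas_inB' v).comp measurable_fst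
    · intro x; rw [nB_cast]; simp
    · intro k x; exact nB_cast v x
  have mt : ∀ k, Measurable fun p : (Fin k → EuclideanSpace ℝ (Fin d)) ×
      EuclideanSpace ℝ (Fin d) => tI (2 * rd d) v p.1 p.2 := fun k =>
    (meas_tI (d := d) (R := 2 * rd d) k).comp
      ((measurable_const.prodMk measurable_fst).prodMk measurable_snd)
  have mg3 : ∀ k, Measurable fun q : (EuclideanSpace ℝ (Fin d) ×
      (Fin k → EuclideanSpace ℝ (Fin d))) × EuclideanSpace ℝ (Fin d) =>
      tI (2 * rd d) v q.1.2 q.2 * inB (2 * rd d) q.1.1 q.2 := fun k =>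
    ((mt k).comp ((measurable_snd.comp measurable_fst).prodMk measurable_snd)).mul
      ((meas_inB (d := d) (R := 2 * rd d)).comp
        ((measurable_fst.comp measurable_fst).prodMk measurable_snd))
  have mg2 : ∀ k, Measurable fun q : EuclideanSpace ℝ (Fin d) ×
      (Fin k → EuclideanSpace ℝ (Fin d)) =>
      ∫⁻ u in S, tI (2 * rd d) v q.2 u * inB (2 * rd d) q.1 u := fun k =>
    (mg3 k).lintegral_prod_right'
  have mg : ∀ k, Measurable fun q : EuclideanSpace ℝ (Fin d) ×
      (Fin k → EuclideanSpace ℝ (Fin d)) => inB (2 * rd d) v q.1 *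
      ∫⁻ u in S, tI (2 * rd d) v q.2 u * inB (2 * rd d) q.1 u := fun k =>
    ((meas_inB' v).comp measurable_fst).mul (mg2 k)
  have e2 : M S l (fun k x => ∑ i, inB (2 * rd d) v (x i) *
        ∫⁻ u in S, tI (2 * rd d) v x u * inB (2 * rd d) (x i) u) =
      l * M S l (fun k x => ∫⁻ w in S, unc (2 * rd d) x w * (inB (2 * rd d) v w *
        ∫⁻ u in S, tI (2 * rd d) v x u * inB (2 * rd d) w u)) := by
    refine M_gnz hS _ (fun _ w x => inB (2 * rd d) v w *
        ∫⁻ u in S, tI (2 * rd d) v x u * inB (2 * rd d) w u) mg ?_ ?_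
    · intro x; simp
    · intro k x
      refine Finset.sum_congr rfl fun i _ => ?_
      rcases le_or_gt (dist (x i) v) (2 * rd d) with hi | hi
      · congr 1
        refine lintegral_congr fun u => ?_
        rw [tI_remove v u x i hi]
      · rw [inB_of_lt hi, zero_mul, zero_mul]
  have e3 : M S l (fun k x => ∫⁻ w in S, unc (2 * rd d) x w * (inB (2 * rd d) v w *
        ∫⁻ u in S, tI (2 * rd d) v x u * inB (2 * rd d) w u)) ≤
      (2 * ENNReal.ofReal (Real.sqrt 3 ^ d)) * M S l (fun _ x => TV S v x) := by
    rw [← M_const_mul hS _ (fun k => meas_TV' v k)]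
    refine M_mono fun k x => ?_
    rw [TV]
    refine le_trans ?_ (pair_bound hd v (fun u => tI (2 * rd d) v x u) (meas_tI' v x)
      (fun u => tI_le_one v u x) (fun u hu => tI_zero v u x hu))
    refine lintegral_mono fun w => ?_
    rw [← mul_assoc]
    exact mul_le_mul_left (unc_inB_le v w x) _
  have e4 : M S l (fun _ x => TV S v x) ≤
      M S l (fun k x => ∫⁻ u in S, unc (2 * rd d) x u * inB (2 * rd d) v u) +
      M S l (fun k x => ∑ i, inB (2 * rd d) v (x i) *
        ∫⁻ u in S, tI (2 * rd d) v x u * inB (2 * rd d) (x i) u) := by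
    rw [← M_add hS fun k => (muB k).lintegral_prod_right']
    refine M_mono fun k x => ?_
    have mx : ∀ i, Measurable fun u : EuclideanSpace ℝ (Fin d) =>
        tI (2 * rd d) v x u * inB (2 * rd d) (x i) u := fun i => (meas_tI' v x).mul (meas_inB' _)
    have f1 : ∑ i, inB (2 * rd d) v (x i) *
        ∫⁻ u in S, tI (2 * rd d) v x u * inB (2 * rd d) (x i) u =
        ∫⁻ u in S, ∑ i, inB (2 * rd d) v (x i) *
          (tI (2 * rd d) v x u * inB (2 * rd d) (x i) u) := by
      rw [lintegral_finsetSum' _ fun i _ => ((mx i).const_mul _).aemeasurable]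
      refine Finset.sum_congr rfl fun i _ => ?_
      exact (lintegral_const_mul (μ := volume.restrict S) _ (mx i)).symm
    rw [f1, TV]
    have mu' : Measurable fun u : EuclideanSpace ℝ (Fin d) =>
      unc (2 * rd d) x u * inB (2 * rd d) v u := (meas_unc' x).mul (meas_inB' v)
    refine le_trans (lintegral_mono fun u => ?_)
      (le_of_eq (lintegral_add_left (μ := volume.restrict S) mu' _))
    refine le_trans (tI_le v u x) ?_
    refine add_le_add_right (le_of_eq ?_) _
    rw [Finset.mul_sum]
    exact Finset.sum_congr rfl fun i _ => by ring
  rw [M_const_mul hS l (fun k => meas_TV' v k), e1]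
  calc l * M S l (fun _ x => TV S v x) ≤ l * (_ + _) := mul_le_mul_right e4 l
    _ = l * M S l (fun k x => ∫⁻ u in S, unc (2 * rd d) x u * inB (2 * rd d) v u) +
        l * (l * M S l (fun k x => ∫⁻ w in S, unc (2 * rd d) x w * (inB (2 * rd d) v w *
        ∫⁻ u in S, tI (2 * rd d) v x u * inB (2 * rd d) w u))) := by rw [e2, mul_add]
    _ ≤ _ + l * (l * ((2 * ENNReal.ofReal (Real.sqrt 3 ^ d)) * M S l (fun _ x => TV S v x))) :=
        add_le_add_right (mul_le_mul_right (mul_le_mul_right e3 l) l) _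
    _ = _ := by ring

lemma M_meas (hS : MeasurableSet S)
    {F : EuclideanSpace ℝ (Fin d) → ∀ k : ℕ, (Fin k → EuclideanSpace ℝ (Fin d)) → ℝ≥0∞}
    (h : ∀ k, Measurable (fun p : EuclideanSpace ℝ (Fin d) ×
      (Fin k → EuclideanSpace ℝ (Fin d)) => F p.1 k p.2)) :
    Measurable fun v => M S l (F v) := by
  unfold M
  have m1 : ∀ k, Measurable (fun p : EuclideanSpace ℝ (Fin d) ×
      (Fin k → EuclideanSpace ℝ (Fin d)) => pI S p.2 * F p.1 k p.2) := fun k =>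
    ((meas_pI hS k).comp measurable_snd).mul (h k)
  exact Measurable.ennreal_tsum fun k => ((m1 k).lintegral_prod_right').const_mul _

lemma unc_eq {k : ℕ} (v : EuclideanSpace ℝ (Fin d)) (x : Fin k → EuclideanSpace ℝ (Fin d)) :
    (if nB R v x = 0 then (1 : ℝ≥0∞) else 0) = unc R x v := by
  unfold nB unc
  simp

lemma meas_ite2 (k : ℕ) : Measurable (fun p : EuclideanSpace ℝ (Fin d) ×
      (Fin k → EuclideanSpace ℝ (Fin d)) => if nB R p.1 p.2 = 0 then (1 : ℝ≥0∞) else 0) := by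
  simp only [unc_eq]
  exact (meas_unc k).comp measurable_swap

lemma A_eq (hS : MeasurableSet S) :
    M S l (fun k _ => (k : ℝ≥0∞)) =
      l * ∫⁻ v in S, M S l (fun _ x => if nB (2 * rd d) v x = 0 then 1 else 0) := by
  rw [M_lint hS (F := fun v _ x => if nB (2 * rd d) v x = 0 then 1 else 0) meas_ite2]
  rw [M_gnz hS _ (fun _ _ _ => 1) (fun k => measurable_const) (by simp) (by simp)]
  simp only [unc_eq, mul_one]

lemma B_le (hd : 1 ≤ d) (hS : MeasurableSet S) :
    ∫⁻ v in S, M S l (fun _ x => ((nB (2 * rd d) v x : ℕ) : ℝ≥0∞)) ≤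
      ENNReal.ofReal (2 ^ d) * M S l (fun k _ => (k : ℝ≥0∞)) := by
  have mn : ∀ k, Measurable fun p : EuclideanSpace ℝ (Fin d) ×
      (Fin k → EuclideanSpace ℝ (Fin d)) => ((nB (2 * rd d) p.1 p.2 : ℕ) : ℝ≥0∞) := fun k =>
    (measurable_from_top (f := fun m : ℕ => (m : ℝ≥0∞))).comp (meas_nB k)
  rw [M_lint hS (F := fun v _ x => ((nB (2 * rd d) v x : ℕ) : ℝ≥0∞)) mn,
    ← M_const_mul hS _ fun k => measurable_const]
  refine M_mono fun k x => ?_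
  simp only [nB_cast]
  have mi : ∀ i, Measurable fun v : EuclideanSpace ℝ (Fin d) => inB (2 * rd d) v (x i) := by
    intro i
    simp only [inB_comm _ (x i)]
    exact meas_inB' _
  rw [lintegral_finsetSum' _ fun i _ => (mi i).aemeasurable]
  have : ∀ i, ∫⁻ v in S, inB (2 * rd d) v (x i) ≤ ENNReal.ofReal (2 ^ d) := by
    intro i
    refine le_trans (setLIntegral_le_lintegral _ _) (le_of_eq ?_)
    rw [← vol_ball hd (x i) 2 (by norm_num), ← lintegral_indicator_one measurableSet_closedBall]
    refine lintegral_congr fun v => ?_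
    rw [inB_comm]
    unfold inB
    simp [Set.indicator]
  refine le_trans (Finset.sum_le_sum fun i _ => this i) ?_
  simp [mul_comm]

lemma int_ineq1 (hS : MeasurableSet S) (hV : volume S ≠ ∞) (hl : l ≠ ∞) (z : ℝ) :
    l * (ENNReal.ofReal (Real.exp (-z) * (1 + z)) * M S l (fun _ _ => 1) * volume S) ≤
      M S l (fun k _ => (k : ℝ≥0∞)) + l * (ENNReal.ofReal (Real.exp (-z)) *
        ∫⁻ v in S, M S l (fun _ x => l * TV S v x)) := by
  have mT : Measurable fun v => M S l (fun _ x => l * TV S v x) :=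
    M_meas hS (F := fun v _ x => l * TV S v x) fun k => (meas_TV k).const_mul l
  have m0 : Measurable fun v => M S l (fun _ x => if nB (2 * rd d) v x = 0 then 1 else 0) :=
    M_meas hS (F := fun v _ x => if nB (2 * rd d) v x = 0 then 1 else 0) meas_ite2
  rw [A_eq hS, ← mul_add]
  refine mul_le_mul_right ?_ l
  have e := lintegral_mono (μ := volume.restrict S) (fun v => step1c (l := l) hS hV hl v z)
  have e2 : ∫⁻ v in S, (M S l (fun k x => if nB (2 * rd d) v x = 0 then 1 else 0) +
      ENNReal.ofReal (Real.exp (-z)) * M S l (fun k x => l * TV S v x)) =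
      (∫⁻ v in S, M S l (fun _ x => if nB (2 * rd d) v x = 0 then 1 else 0)) +
      ENNReal.ofReal (Real.exp (-z)) * ∫⁻ v in S, M S l (fun _ x => l * TV S v x) := by
    have h1 := lintegral_add_left (μ := volume.restrict S) m0
      (fun v => ENNReal.ofReal (Real.exp (-z)) * M S l (fun k x => l * TV S v x))
    have h2 := lintegral_const_mul (μ := volume.restrict S) (ENNReal.ofReal (Real.exp (-z))) mT
    exact h1.trans (by rw [h2])
  rw [e2, setLIntegral_const] at e
  exact e

lemma int_ineq2 (hd : 1 ≤ d) (hS : MeasurableSet S) :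
    ∫⁻ v in S, M S l (fun _ x => l * TV S v x) ≤
      ENNReal.ofReal (2 ^ d) * M S l (fun k _ => (k : ℝ≥0∞)) +
      l * (2 * ENNReal.ofReal (Real.sqrt 3 ^ d)) *
        ∫⁻ v in S, M S l (fun _ x => l * TV S v x) := by
  have mT : Measurable fun v => M S l (fun _ x => l * TV S v x) :=
    M_meas hS (F := fun v _ x => l * TV S v x) fun k => (meas_TV k).const_mul l
  have mn : ∀ k, Measurable fun p : EuclideanSpace ℝ (Fin d) ×
      (Fin k → EuclideanSpace ℝ (Fin d)) => ((nB (2 * rd d) p.1 p.2 : ℕ) : ℝ≥0∞) := fun k =>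
    (measurable_from_top (f := fun m : ℕ => (m : ℝ≥0∞))).comp (meas_nB k)
  have mN : Measurable fun v => M S l (fun _ x => ((nB (2 * rd d) v x : ℕ) : ℝ≥0∞)) :=
    M_meas hS (F := fun v _ x => ((nB (2 * rd d) v x : ℕ) : ℝ≥0∞)) mn
  have e := lintegral_mono (μ := volume.restrict S) (fun v => step2 (l := l) hd hS v)
  refine le_trans e ?_
  refine le_trans (le_of_eq (lintegral_add_left (μ := volume.restrict S) mN _)) ?_
  refine add_le_add (B_le hd hS) (le_of_eq ?_)
  exact lintegral_const_mul (μ := volume.restrict S) _ mT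

lemma lint_pI (hS : MeasurableSet S) (k : ℕ) :
    ∫⁻ x : Fin k → EuclideanSpace ℝ (Fin d), pI S x = volume (packSet d k S) := by
  unfold pI
  exact lintegral_indicator_one (meas_packSet hS k)

lemma vol_pack_le (k : ℕ) : volume (packSet d k S) ≤ (volume S) ^ k := by
  have : packSet d k S ⊆ Set.pi Set.univ fun _ => S := fun x hx i _ => hx.1 i
  refine le_trans (measure_mono this) ?_
  rw [volume_pi_pi]; simp

lemma Z_fin (hS : MeasurableSet S) (hV : volume S ≠ ∞) (hl : l ≠ ∞) :
    M S l (fun _ _ => 1) ≠ ∞ := by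
  have h := tsum_exp (l * volume S) (ENNReal.mul_ne_top hl hV)
  refine ne_top_of_le_ne_top (b := ∑' n : ℕ, ((n.factorial : ℝ≥0∞))⁻¹ * (l * volume S) ^ n)
    (by rw [h]; exact ENNReal.ofReal_ne_top) ?_
  unfold M
  refine ENNReal.tsum_le_tsum fun k => ?_
  simp only [mul_one, lint_pI hS]
  rw [ENNReal.div_eq_inv_mul, mul_pow, mul_assoc]
  gcongr
  exact vol_pack_le k

lemma A_fin (hS : MeasurableSet S) (hV : volume S ≠ ∞) (hl : l ≠ ∞) :
    M S l (fun k _ => (k : ℝ≥0∞)) ≠ ∞ := by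
  rw [A_eq hS]
  refine ENNReal.mul_ne_top hl ?_
  refine ne_top_of_le_ne_top (b := ∫⁻ v in S, M S l (fun _ _ => 1)) ?_ ?_
  · rw [setLIntegral_const]
    exact ENNReal.mul_ne_top (Z_fin hS hV hl) hV
  · refine lintegral_mono fun v => M_mono fun k x => ?_
    split_ifs <;> simp

lemma W_fin (hS : MeasurableSet S) (hV : volume S ≠ ∞) (hl : l ≠ ∞) :
    ∫⁻ v in S, M S l (fun _ x => l * TV S v x) ≠ ∞ := by
  refine ne_top_of_le_ne_top (b := ∫⁻ v in S, M S l (fun _ _ => l * volume S * 1)) ?_ ?_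
  · rw [setLIntegral_const, M_const_mul hS _ fun k => measurable_const]
    exact ENNReal.mul_ne_top (ENNReal.mul_ne_top (ENNReal.mul_ne_top hl hV) (Z_fin hS hV hl)) hV
  · refine lintegral_mono fun v => M_mono fun k x => ?_
    rw [mul_one]
    exact mul_le_mul_right (TV_le v x) l

lemma term_eq (hS : MeasurableSet S) (lam : ℝ) (hl : 0 ≤ lam) (k : ℕ) :
    lam ^ k * Zhat d S k = (ENNReal.ofReal lam ^ k / (Nat.factorial k : ℝ≥0∞) *
      volume (packSet d k S)).toReal := by
  have : ∫ x : Fin k → EuclideanSpace ℝ (Fin d),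
      Set.indicator (packSet d k S) (fun _ => (1 : ℝ)) x = (volume (packSet d k S)).toReal := by
    rw [integral_indicator (meas_packSet hS k)]
    simp [Measure.real]
  rw [Zhat, this, ENNReal.toReal_mul, ENNReal.toReal_div, ENNReal.toReal_pow,
    ENNReal.toReal_ofReal hl, ENNReal.toReal_natCast]
  ring

lemma term_fin (hV : volume S ≠ ∞) (lam : ℝ) (k : ℕ) :
    ENNReal.ofReal lam ^ k / (Nat.factorial k : ℝ≥0∞) * volume (packSet d k S) ≠ ∞ := by
  refine ENNReal.mul_ne_top (ENNReal.div_ne_top (ENNReal.pow_ne_top ENNReal.ofReal_ne_top)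
    (by simp [Nat.factorial_ne_zero])) ?_
  exact ne_top_of_le_ne_top (ENNReal.pow_ne_top hV) (vol_pack_le k)

lemma M_one (hS : MeasurableSet S) : M S l (fun _ _ => 1) =
    ∑' k : ℕ, l ^ k / (Nat.factorial k : ℝ≥0∞) * volume (packSet d k S) := by
  unfold M
  simp only [mul_one, lint_pI hS]

lemma M_k (hS : MeasurableSet S) : M S l (fun k _ => (k : ℝ≥0∞)) =
    ∑' k : ℕ, (k : ℝ≥0∞) * (l ^ k / (Nat.factorial k : ℝ≥0∞) * volume (packSet d k S)) := by
  unfold M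
  refine tsum_congr fun k => ?_
  rw [lintegral_mul_const _ (meas_pI hS k), lint_pI hS]
  ring

lemma term_eq' (hS : MeasurableSet S) (lam : ℝ) (hl : 0 ≤ lam) (k : ℕ) :
    (k : ℝ) * lam ^ k * Zhat d S k = ((k : ℝ≥0∞) * (ENNReal.ofReal lam ^ k /
      (Nat.factorial k : ℝ≥0∞) * volume (packSet d k S))).toReal := by
  rw [mul_assoc, term_eq hS lam hl, ENNReal.toReal_mul (a := (k : ℝ≥0∞)), ENNReal.toReal_natCast]

lemma Zgc_eq (hS : MeasurableSet S) (hV : volume S ≠ ∞) (lam : ℝ) (hl : 0 ≤ lam) :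
    Zgc d S lam = (M S (ENNReal.ofReal lam) (fun _ _ => 1)).toReal ∧
    Summable (fun k : ℕ => lam ^ k * Zhat d S k) := by
  have h := Z_fin (l := ENNReal.ofReal lam) hS hV ENNReal.ofReal_ne_top
  rw [M_one hS] at h ⊢
  rw [Zgc]
  simp only [term_eq hS lam hl]
  exact ⟨(ENNReal.tsum_toReal_eq (term_fin hV lam)).symm, ENNReal.summable_toReal h⟩

lemma Anum_eq (hS : MeasurableSet S) (hV : volume S ≠ ∞) (lam : ℝ) (hl : 0 ≤ lam) :
    (∑' k : ℕ, (k : ℝ) * lam ^ k * Zhat d S k) =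
      (M S (ENNReal.ofReal lam) (fun k _ => (k : ℝ≥0∞))).toReal ∧
    Summable (fun k : ℕ => (k : ℝ) * lam ^ k * Zhat d S k) := by
  have h := A_fin (l := ENNReal.ofReal lam) hS hV ENNReal.ofReal_ne_top
  rw [M_k hS] at h ⊢
  simp only [term_eq' hS lam hl]
  exact ⟨(ENNReal.tsum_toReal_eq fun k => ENNReal.mul_ne_top (ENNReal.natCast_ne_top _)
    (term_fin hV lam k)).symm, ENNReal.summable_toReal h⟩

lemma Zhat_nonneg (k : ℕ) : 0 ≤ Zhat d S k := by
  unfold Zhat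
  refine mul_nonneg (by positivity) (integral_nonneg fun x => ?_)
  exact Set.indicator_nonneg (fun _ _ => zero_le_one) _

lemma Zhat_zero : Zhat d S 0 = 1 := by
  have : packSet d 0 S = Set.univ := by
    ext x; simp [packSet]
  unfold Zhat
  rw [this]
  have h := volume_pi_pi (fun _ : Fin 0 => (Set.univ : Set (EuclideanSpace ℝ (Fin d))))
  rw [Set.pi_univ, Finset.univ_eq_empty, Finset.prod_empty] at h
  simp
  have h2 := congrArg ENNReal.toReal h
  simpa [Measure.real] using h2

lemma Zgc_pos (hS : MeasurableSet S) (hV : volume S ≠ ∞) (lam : ℝ) (hl : 0 ≤ lam) :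
    1 ≤ Zgc d S lam := by
  have h := (Zgc_eq hS hV lam hl).2
  have := h.le_tsum 0 (fun k _ => mul_nonneg (pow_nonneg hl k) (Zhat_nonneg k))
  simpa [Zhat_zero, Zgc] using this

lemma alpha_mono (hS : MeasurableSet S) (hV : volume S ≠ ∞) (lam mu : ℝ) (hl : 0 < lam)
    (hlm : lam ≤ mu) : alphaS d S lam ≤ alphaS d S mu := by
  have hmu : 0 < mu := hl.trans_le hlm
  obtain ⟨-, sZl⟩ := Zgc_eq hS hV lam hl.le
  obtain ⟨-, sZm⟩ := Zgc_eq hS hV mu hmu.le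
  obtain ⟨-, sAl⟩ := Anum_eq hS hV lam hl.le
  obtain ⟨-, sAm⟩ := Anum_eq hS hV mu hmu.le
  have pl := Zgc_pos hS hV lam hl.le
  have pm := Zgc_pos hS hV mu hmu.le
  unfold alphaS
  set Al := ∑' k : ℕ, (k : ℝ) * lam ^ k * Zhat d S k with hAl
  set Am := ∑' k : ℕ, (k : ℝ) * mu ^ k * Zhat d S k with hAm
  have main : Al / Zgc d S lam ≤ Am / Zgc d S mu := by
    set m := Al / Zgc d S lam with hm
    have hmz : m * Zgc d S lam = Al := div_mul_cancel₀ _ (by positivity)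
    rw [le_div_iff₀ (by positivity)]
    set t := mu / lam with ht
    have ht1 : 1 ≤ t := (one_le_div hl).mpr hlm
    have ht0 : 0 < t := by positivity
    have hmut : mu = t * lam := (div_mul_cancel₀ _ hl.ne').symm
    have pt : ∀ k : ℕ, t ^ m * ((k : ℝ) * lam ^ k * Zhat d S k - m * (lam ^ k * Zhat d S k)) ≤
        (k : ℝ) * mu ^ k * Zhat d S k - m * (mu ^ k * Zhat d S k) := by
      intro k
      have h1 : 0 ≤ ((k : ℝ) - m) * (t ^ (k : ℝ) - t ^ m) := by
        rcases le_total m k with h | h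
        · exact mul_nonneg (by linarith)
            (sub_nonneg.mpr (Real.rpow_le_rpow_of_exponent_le ht1 h))
        · exact mul_nonneg_of_nonpos_of_nonpos (by linarith)
            (sub_nonpos.mpr (Real.rpow_le_rpow_of_exponent_le ht1 h))
      have h2 : 0 ≤ lam ^ k * Zhat d S k := mul_nonneg (by positivity) (Zhat_nonneg k)
      have h3 := mul_nonneg h1 h2
      rw [Real.rpow_natCast] at h3
      have h4 : mu ^ k = t ^ k * lam ^ k := by rw [hmut, mul_pow]
      rw [h4]
      linarith
    have s1 : Summable fun k : ℕ => (k : ℝ) * lam ^ k * Zhat d S k - m * (lam ^ k * Zhat d S k) :=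
      sAl.sub (sZl.mul_left m)
    have s2 : Summable fun k : ℕ => (k : ℝ) * mu ^ k * Zhat d S k - m * (mu ^ k * Zhat d S k) :=
      sAm.sub (sZm.mul_left m)
    have h := (s1.mul_left (t ^ m)).tsum_le_tsum pt s2
    rw [tsum_mul_left, sAl.tsum_sub (sZl.mul_left m), sAm.tsum_sub (sZm.mul_left m),
      tsum_mul_left, tsum_mul_left, ← hAl, ← hAm, ← Zgc, ← Zgc, hmz] at h
    simp only [sub_self, mul_zero] at h
    linarith
  rw [mul_comm, mul_comm _ (Zgc d S mu), ← div_div, ← div_div]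
  exact div_le_div_of_nonneg_right main ENNReal.toReal_nonneg

lemma real_ineqs (hd : 1 ≤ d) (hS : MeasurableSet S) (hV : volume S ≠ ∞) (hV0 : 0 < volume S)
    (lam : ℝ) (hl : 0 < lam) (z : ℝ) : ∃ w : ℝ, 0 ≤ w ∧
      lam * Real.exp (-z) * (1 + z) ≤ alphaS d S lam + lam * Real.exp (-z) * w ∧
      w ≤ 2 ^ d * alphaS d S lam + lam * 2 * Real.sqrt 3 ^ d * w := by
  have hlt : ENNReal.ofReal lam ≠ ∞ := ENNReal.ofReal_ne_top
  have i1 := int_ineq1 (l := ENNReal.ofReal lam) hS hV hlt z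
  have i2 := int_ineq2 (l := ENNReal.ofReal lam) hd hS
  have hZ := Zgc_pos hS hV lam hl.le
  have hvp : 0 < (volume S).toReal := ENNReal.toReal_pos hV0.ne' hV
  have zf := Z_fin hS hV hlt
  have af := A_fin hS hV hlt
  have wf := W_fin hS hV hlt
  have ea := (Anum_eq hS hV lam hl.le).1
  have ez := (Zgc_eq hS hV lam hl.le).1
  set W := ∫⁻ v in S, M S (ENNReal.ofReal lam) (fun _ x => ENNReal.ofReal lam * TV S v x)
  set A := M S (ENNReal.ofReal lam) (fun k _ => (k : ℝ≥0∞))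
  set Z := M S (ENNReal.ofReal lam) (fun _ _ => 1)
  rw [← ENNReal.ofReal_toReal zf, ← ENNReal.ofReal_toReal af, ← ENNReal.ofReal_toReal wf,
    ← ENNReal.ofReal_toReal hV, ← ez] at i1
  rw [← ENNReal.ofReal_toReal af, ← ENNReal.ofReal_toReal wf] at i2
  have hα : alphaS d S lam * ((volume S).toReal * Zgc d S lam) = A.toReal := by
    unfold alphaS
    rw [ea, div_mul_cancel₀ _ (by positivity)]
  set a := A.toReal
  set w := W.toReal
  have hw : 0 ≤ w := ENNReal.toReal_nonneg
  have ha : 0 ≤ a := ENNReal.toReal_nonneg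
  set V := (volume S).toReal
  set ζ := Zgc d S lam
  have hq : (0:ℝ) < V * ζ := by positivity
  have r2 : w ≤ 2 ^ d * a + lam * (2 * Real.sqrt 3 ^ d) * w := by
    have e2 : (2 : ℝ≥0∞) = ENNReal.ofReal 2 := by simp
    rw [e2, ← ENNReal.ofReal_mul (by positivity), ← ENNReal.ofReal_mul (by positivity),
      ← ENNReal.ofReal_mul (by positivity), ← ENNReal.ofReal_mul (by positivity),
      ← ENNReal.ofReal_add (by positivity) (by positivity),
      ENNReal.ofReal_le_ofReal_iff (by positivity)] at i2
    exact i2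
  have r1 : lam * (Real.exp (-z) * (1 + z) * ζ * V) ≤ a + lam * (Real.exp (-z) * w) := by
    have hz : 0 ≤ a + lam * (Real.exp (-z) * w) := by positivity
    rw [← ENNReal.ofReal_mul' (by positivity), ← ENNReal.ofReal_mul' (by positivity),
      ← ENNReal.ofReal_mul (by positivity), ← ENNReal.ofReal_mul (by positivity),
      ← ENNReal.ofReal_mul (by positivity),
      ← ENNReal.ofReal_add (by positivity) (by positivity),
      ENNReal.ofReal_le_ofReal_iff hz] at i1
    exact i1
  refine ⟨w / (V * ζ), by positivity, ?_, ?_⟩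
  · refine le_of_mul_le_mul_right ?_ hq
    calc lam * Real.exp (-z) * (1 + z) * (V * ζ) = lam * (Real.exp (-z) * (1 + z) * ζ * V) := by ring
      _ ≤ _ := r1
      _ = _ := by rw [← hα]; field_simp
  · refine le_of_mul_le_mul_right ?_ hq
    calc w / (V * ζ) * (V * ζ) = w := by field_simp
      _ ≤ _ := r2
      _ = _ := by rw [← hα]; field_simp

lemma asymp (ε : ℝ) (hε : 0 < ε) : ∀ᶠ d : ℕ in atTop,
    (1 - ε) * Real.log (2 / Real.sqrt 3) * d * (1 / d + 1 / (1 - 2 / d)) ≤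
      1 + (d * Real.log (2 / Real.sqrt 3) - 2 * Real.log d) := by
  set L := Real.log (2 / Real.sqrt 3) with hL
  have hLp : 0 < L := by
    refine Real.log_pos ?_
    rw [one_lt_div (by positivity), Real.sqrt_lt' (by norm_num)]
    norm_num
  have t1 : Tendsto (fun d : ℕ => (d : ℝ)⁻¹) atTop (nhds 0) := tendsto_inv_atTop_nhds_zero_nat
  have t2 : Tendsto (fun d : ℕ => Real.log d / (d : ℝ)) atTop (nhds 0) := by
    have := (Real.isLittleO_log_id_atTop.tendsto_div_nhds_zero).comp
      (tendsto_natCast_atTop_atTop (R := ℝ))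
    exact this
  have t3 : Tendsto (fun d : ℕ => (1 - ε) * L * ((d : ℝ)⁻¹ + (1 - 2 * (d : ℝ)⁻¹)⁻¹)) atTop
      (nhds ((1 - ε) * L * (0 + (1 - 2 * 0)⁻¹))) := by
    refine Tendsto.const_mul _ (t1.add (Tendsto.inv₀ ?_ (by norm_num)))
    exact tendsto_const_nhds.sub (t1.const_mul 2)
  have t4 : Tendsto (fun d : ℕ => (d : ℝ)⁻¹ + (L - 2 * (Real.log d / d))) atTop
      (nhds (0 + (L - 2 * 0))) := t1.add (tendsto_const_nhds.sub (t2.const_mul 2))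
  have hlt : (1 - ε) * L * (0 + (1 - 2 * 0)⁻¹) < 0 + (L - 2 * 0) := by
    norm_num; nlinarith
  filter_upwards [t3.eventually_lt t4 hlt, eventually_gt_atTop 0] with d h hd
  have hd' : (0 : ℝ) < d := by exact_mod_cast hd
  have := mul_le_mul_of_nonneg_left h.le hd'.le
  calc _ = (d : ℝ) * ((1 - ε) * L * ((d : ℝ)⁻¹ + (1 - 2 * (d : ℝ)⁻¹)⁻¹)) := by
        rw [one_div, one_div, div_eq_mul_inv 2 (d : ℝ)]; ring
    _ ≤ _ := this
    _ = _ := by field_simp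

end HS

/-- for every `ε > 0`, for all large `d`, every bounded measurable `S` of
positive volume and every `λ ≥ 3^{-d/2}`, the expected packing density satisfies
`α_S(λ) ≥ (1-ε) log(2/√3) d 2^{-d}`. -/
theorem hard_sphere_expected_density_lower_bound :
    ∀ ε : ℝ, 0 < ε → ∃ d₀ : ℕ, ∀ d : ℕ, d₀ ≤ d →
      ∀ S : Set (EuclideanSpace ℝ (Fin d)), Bornology.IsBounded S → MeasurableSet S →
        0 < volume S →
      ∀ lam : ℝ, (3 : ℝ) ^ (-(d : ℝ) / 2) ≤ lam →
        alphaS d S lam ≥ (1 - ε) * Real.log (2 / Real.sqrt 3) * d / 2 ^ d := by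
  intro ε hε
  obtain ⟨d₁, hd₁⟩ := eventually_atTop.mp (HS.asymp ε hε)
  refine ⟨max d₁ 3, fun d hd S hb hS hV0 lam hlam => ?_⟩
  have hd3 : 3 ≤ d := le_trans (le_max_right _ _) hd
  have has := hd₁ d (le_trans (le_max_left _ _) hd)
  have hV : volume S ≠ ∞ := hb.measure_lt_top.ne
  have hdp : (3 : ℝ) ≤ d := by exact_mod_cast hd3
  have hs3 : 0 < Real.sqrt 3 ^ d := by positivity
  have h3 : (3 : ℝ) ^ (-(d : ℝ) / 2) = (Real.sqrt 3 ^ d)⁻¹ := by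
    rw [neg_div, Real.rpow_neg (by norm_num), Real.sqrt_eq_rpow, ← Real.rpow_natCast,
      ← Real.rpow_mul (by norm_num)]
    congr 2; ring
  set l0 : ℝ := (Real.sqrt 3 ^ d)⁻¹ / d with hl0
  have hl0p : 0 < l0 := by positivity
  have hle : l0 ≤ lam := by
    refine le_trans ?_ hlam
    rw [h3]
    exact div_le_self (by positivity) (by linarith)
  refine ge_iff_le.mpr (le_trans ?_ (HS.alpha_mono hS hV l0 lam hl0p hle))
  set L := Real.log (2 / Real.sqrt 3) with hL
  set z := d * L - 2 * Real.log d with hz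
  obtain ⟨w, hw, i1, i2⟩ := HS.real_ineqs (by omega) hS hV hV0 l0 hl0p z
  set α := alphaS d S l0
  have hexp : l0 * Real.exp (-z) = d / 2 ^ d := by
    have e1 : Real.exp (d * L) = 2 ^ d / Real.sqrt 3 ^ d := by
      rw [mul_comm, Real.exp_mul, hL, Real.exp_log (by positivity), Real.rpow_natCast, div_pow]
    have e2 : Real.exp (2 * Real.log d) = (d : ℝ) ^ 2 := by
      rw [mul_comm, Real.exp_mul, Real.exp_log (by positivity)]; norm_num
    rw [hz, neg_sub, Real.exp_sub, e1, e2, hl0]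
    field_simp
  have hll : l0 * 2 * Real.sqrt 3 ^ d = 2 / d := by
    rw [hl0]; field_simp
  rw [hexp] at i1
  rw [hll] at i2
  have h2d : (0 : ℝ) < 2 ^ d := by positivity
  have hδ : 0 < 1 - 2 / (d : ℝ) := by
    rw [sub_pos, div_lt_one (by linarith)]; linarith
  have hwle : w ≤ 2 ^ d * α / (1 - 2 / d) := by
    rw [le_div_iff₀ hδ]; linarith
  have i1' : 1 + z ≤ 2 ^ d * α * (1 / d) + w := by
    have := mul_le_mul_of_nonneg_left i1 (show (0:ℝ) ≤ 2 ^ d / d by positivity)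
    calc 1 + z = 2 ^ d / d * (d / 2 ^ d * (1 + z)) := by field_simp
      _ ≤ _ := this
      _ = _ := by field_simp
  have fin : (1 - ε) * L * d * (1 / d + 1 / (1 - 2 / d)) ≤
      2 ^ d * α * (1 / d + 1 / (1 - 2 / d)) := by
    refine has.trans (i1'.trans ?_)
    rw [mul_add]
    have : 2 ^ d * α * (1 / (1 - 2 / (d:ℝ))) = 2 ^ d * α / (1 - 2 / d) := by ring
    rw [this]; linarith
  have := le_of_mul_le_mul_right fin (by positivity)
  rw [div_le_iff₀ h2d]; linarith
end

section
/- For every c with log(3)/2 ≤ c < log 2 and every ε > 0 there exists d₀ such that for all dimensions d ≥ d₀, setting λ = e^{-c·d}: liminf_{n→∞} (1/n) · log Z_{B_n}(λ) ≥ ( (log 2 − c)²/2 − ε ) · d² · 2^{-d}. (This is the lower bound g_d(λ) ≥ ((log 2 − c)²/2 + o_d(1)) · d²/2^d on the pressure of the hard sphere model.) -/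
open MeasureTheory Filter

open scoped ENNReal NNReal

set_option linter.unusedSectionVars false

section HS

variable {E : Type*} [PseudoMetricSpace E] [MeasureSpace E] [OpensMeasurableSpace E]
  [SecondCountableTopology E] [SigmaFinite (volume : Measure E)]

/-- packings indexed by an arbitrary type -/
def pk (r : ℝ) (ι : Type) (U : Set E) : Set (ι → E) :=
  {x | (∀ i, x i ∈ U) ∧ ∀ i j, i ≠ j → r < dist (x i) (x j)}

/-- the part of `U` not covered by the ball at `u` -/
def far (r : ℝ) (U : Set E) (u : E) : Set E := {p | p ∈ U ∧ r < dist p u}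

/-- the externally uncovered region -/
def Tr (r : ℝ) (U B : Set E) {ι : Type} (w : ι → E) : Set E :=
  {p | p ∈ U ∧ p ∈ B ∧ ∀ i, r < dist p (w i)}

/-- the coefficient `t^k/k!` -/
noncomputable def cf (t : ℝ≥0∞) (k : ℕ) : ℝ≥0∞ := t ^ k / (k.factorial : ℝ≥0∞)

/-- partition function in `ℝ≥0∞` -/
noncomputable def ZE (r : ℝ) (t : ℝ≥0∞) (U : Set E) : ℝ≥0∞ :=
  ∑' k : ℕ, cf t k * volume (pk r (Fin k) U)

/-- first moment -/
noncomputable def ME (r : ℝ) (t : ℝ≥0∞) (U : Set E) : ℝ≥0∞ :=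
  t * ∫⁻ u in U, ZE r t (far r U u)

theorem measurableSet_forall {α : Type*} [MeasurableSpace α] {ι : Type*} [Countable ι]
    {p : ι → α → Prop} (h : ∀ i, MeasurableSet {x | p i x}) : MeasurableSet {x | ∀ i, p i x} := by
  rw [Set.ofPred_forall]
  exact MeasurableSet.iInter h

theorem measurableSet_pk (r : ℝ) (ι : Type) [Countable ι] {U : Set E} (hU : MeasurableSet U) :
    MeasurableSet (pk r ι U) := by
  refine MeasurableSet.inter (s₁ := {x : ι → E | ∀ i, x i ∈ U})
    (s₂ := {x : ι → E | ∀ i j, i ≠ j → r < dist (x i) (x j)}) ?_ ?_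
  · exact measurableSet_forall fun i => (measurable_pi_apply i) hU
  · refine measurableSet_forall fun i => measurableSet_forall fun j => ?_
    by_cases hij : i = j
    · simp [hij]
    simp only [ne_eq, hij, not_false_eq_true, forall_true_left]
    exact measurableSet_lt measurable_const ((measurable_pi_apply i).dist (measurable_pi_apply j))

theorem measurable_far (r : ℝ) {U : Set E} (hU : MeasurableSet U) (u : E) :
    MeasurableSet (far r U u) :=
  hU.inter (measurableSet_lt measurable_const (measurable_id.dist measurable_const))

theorem measurable_Tr (r : ℝ) {U B : Set E} (hU : MeasurableSet U) (hB : MeasurableSet B)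
    {ι : Type} [Countable ι] (w : ι → E) :
    MeasurableSet (Tr r U B w) := by
  refine hU.inter (hB.inter ?_)
  have : {p : E | ∀ i, r < dist p (w i)} = ⋂ i, {p : E | r < dist p (w i)} := by ext x; simp
  change MeasurableSet {p : E | ∀ i, r < dist p (w i)}
  rw [this]
  exact MeasurableSet.iInter fun i =>
    (measurableSet_lt measurable_const (measurable_id.dist measurable_const))

/-- pairs (exterior, interior) -/
def Gs (r : ℝ) (U B : Set E) (l m : ℕ) : Set ((Fin l → E) × (Fin m → E)) :=
  {q | q.1 ∈ pk r (Fin l) (U \ B) ∧ q.2 ∈ pk r (Fin m) (Tr r U B q.1)}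

theorem measurableSet_Gs (r : ℝ) {U B : Set E} (hU : MeasurableSet U) (hB : MeasurableSet B)
    (l m : ℕ) : MeasurableSet (Gs r U B l m) := by
  refine MeasurableSet.inter (measurable_fst (measurableSet_pk r (Fin l) (hU.diff hB))) ?_
  have : {q : (Fin l → E) × (Fin m → E) | q.2 ∈ pk r (Fin m) (Tr r U B q.1)}
     = {q | q.2 ∈ pk r (Fin m) (U ∩ B)} ∩ {q | ∀ i, ∀ j, r < dist (q.2 i) (q.1 j)} := by
    ext q
    simp only [pk, Tr, Set.mem_ofPred_eq, Set.mem_inter_iff]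
    constructor
    · rintro ⟨h1, h2⟩
      exact ⟨⟨fun i => ⟨(h1 i).1, (h1 i).2.1⟩, h2⟩, fun i => (h1 i).2.2⟩
    · rintro ⟨⟨h1, h2⟩, h3⟩
      exact ⟨fun i => ⟨(h1 i).1, (h1 i).2, h3 i⟩, h2⟩
  change MeasurableSet {q : (Fin l → E) × (Fin m → E) | q.2 ∈ pk r (Fin m) (Tr r U B q.1)}
  rw [this]
  refine MeasurableSet.inter (measurable_snd (measurableSet_pk r (Fin m) (hU.inter hB))) ?_
  refine measurableSet_forall fun i => measurableSet_forall fun j => ?_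
  exact measurableSet_lt measurable_const
    (((measurable_pi_apply i).comp measurable_snd).dist ((measurable_pi_apply j).comp measurable_fst))

theorem vol_Gs (r : ℝ) {U B : Set E} (hU : MeasurableSet U) (hB : MeasurableSet B) (l m : ℕ) :
    volume (Gs r U B l m) =
      ∫⁻ w in pk r (Fin l) (U \ B), volume (pk r (Fin m) (Tr r U B w)) := by
  rw [Measure.volume_eq_prod, Measure.prod_apply (measurableSet_Gs r hU hB l m),
    ← lintegral_indicator (measurableSet_pk r (Fin l) (hU.diff hB))]
  congr 1
  ext w
  by_cases hw : w ∈ pk r (Fin l) (U \ B)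
  · rw [Set.indicator_of_mem hw]
    congr 1
    ext y
    simp [Gs, hw]
  · rw [Set.indicator_of_notMem hw]
    have : Prod.mk w ⁻¹' Gs r U B l m = ∅ := by
      ext y
      simp [Gs, hw]
    rw [this, measure_empty]

theorem vol_split_one (r : ℝ) {U B : Set E} (hU : MeasurableSet U) (hB : MeasurableSet B)
    (k l m : ℕ) (s : Finset (Fin k)) (hl : sᶜ.card = l) (hm : s.card = m) :
    volume {x : Fin k → E | x ∈ pk r (Fin k) U ∧ ∀ i, i ∈ s ↔ x i ∈ B} =
      volume (Gs r U B l m) := by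
  have hm' : sᶜᶜ.card = m := by simpa using hm
  let e : Fin l ⊕ Fin m ≃ Fin k := finSumEquivOfFinset hl hm'
  have he1 : ∀ i, e (Sum.inl i) ∉ s := by
    intro i
    have : e (Sum.inl i) ∈ sᶜ := by
      simp only [e, finSumEquivOfFinset_inl]
      exact Finset.orderEmbOfFin_mem _ _ _
    simpa using this
  have he2 : ∀ i, e (Sum.inr i) ∈ s := by
    intro i
    have : e (Sum.inr i) ∈ sᶜᶜ := by
      simp only [e, finSumEquivOfFinset_inr]
      exact Finset.orderEmbOfFin_mem _ _ _
    simpa using this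
  have h1 := volume_measurePreserving_piCongrLeft (fun _ : Fin k => E) e
  have h2 := volume_measurePreserving_sumPiEquivProdPi_symm (fun _ : Fin l ⊕ Fin m => E)
  have h3 := h1.comp h2
  have hms : MeasurableSet {x : Fin k → E | x ∈ pk r (Fin k) U ∧ ∀ i, i ∈ s ↔ x i ∈ B} := by
    refine (measurableSet_pk r (Fin k) hU).inter ?_
    refine measurableSet_forall fun i => ?_
    by_cases hi : i ∈ s
    · simp only [hi, true_iff]
      exact (measurable_pi_apply i) hB
    · simp only [hi, false_iff]
      exact ((measurable_pi_apply (X := fun _ : Fin k => E) i) hB).compl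
  rw [← h3.measure_preimage hms.nullMeasurableSet]
  congr 1
  ext ⟨w, y⟩
  set x := (⇑(MeasurableEquiv.piCongrLeft (fun _ : Fin k => E) e) ∘
    ⇑(MeasurableEquiv.sumPiEquivProdPi (fun _ : Fin l ⊕ Fin m => E)).symm) (w, y) with hx
  have x1 : ∀ i, x (e (Sum.inl i)) = w i := fun i =>
    Equiv.piCongrLeft_sumInl (fun _ : Fin k => E) e w y i
  have x2 : ∀ i, x (e (Sum.inr i)) = y i := fun i =>
    Equiv.piCongrLeft_sumInr (fun _ : Fin k => E) e w y i
  rw [Set.mem_preimage, ← hx]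
  simp only [pk, Gs, Tr, Set.mem_ofPred_eq, ← e.forall_congr_right, Sum.forall, x1, x2, he1, he2,
    e.injective.ne_iff, ne_eq, Sum.inl.injEq, Sum.inr.injEq, reduceCtorEq, not_false_eq_true,
    true_iff, false_iff, forall_true_left, Set.mem_sdiff]
  constructor
  · rintro ⟨⟨⟨a1, a2⟩, a3, a4⟩, a5, a6⟩
    exact ⟨⟨fun i => ⟨a1 i, a5 i⟩, fun i => (a3 i).1⟩,
      fun j => ⟨a2 j, a6 j, (a4 j).1⟩, fun i => (a4 i).2⟩
  · rintro ⟨⟨b1, b2⟩, b3, b4⟩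
    exact ⟨⟨⟨fun i => (b1 i).1, fun i => (b3 i).1⟩,
      ⟨fun i => ⟨b2 i, fun j => by rw [dist_comm]; exact (b3 j).2.2 i⟩,
       fun j => ⟨(b3 j).2.2, b4 j⟩⟩⟩, fun i => (b1 i).2, fun i => (b3 i).2.1⟩

theorem vol_split (r : ℝ) {U B : Set E} (hU : MeasurableSet U) (hB : MeasurableSet B) (k : ℕ) :
    volume (pk r (Fin k) U) =
      ∑ m ∈ Finset.range (k + 1), (k.choose m : ℝ≥0∞) * volume (Gs r U B (k - m) m) := by
  classical
  have h1 : pk r (Fin k) U = ⋃ s ∈ (Finset.univ : Finset (Fin k)).powerset,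
      {x : Fin k → E | x ∈ pk r (Fin k) U ∧ ∀ i, i ∈ s ↔ x i ∈ B} := by
    ext x
    simp only [Finset.powerset_univ, Finset.mem_univ, Set.iUnion_true, Set.mem_iUnion,
      Set.mem_ofPred_eq, exists_and_left]
    refine ⟨fun h => ⟨h, Finset.univ.filter (fun i => x i ∈ B), by simp⟩, fun h => h.1⟩
  have h2 := Finset.sum_powerset_apply_card
    (fun m => volume (Gs r U B (k - m) m)) (x := (Finset.univ : Finset (Fin k)))
  simp only [Finset.card_univ, Fintype.card_fin, nsmul_eq_mul] at h2
  rw [← h2]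
  conv_lhs => rw [h1]
  rw [measure_biUnion_finset]
  · refine Finset.sum_congr rfl fun s _ => ?_
    exact vol_split_one r hU hB k _ _ s (by rw [Finset.card_compl, Fintype.card_fin]) rfl
  · intro s _ s' _ hne
    refine Set.disjoint_left.2 ?_
    rintro x ⟨_, hx⟩ ⟨_, hx'⟩
    exact hne (Finset.ext fun i => (hx i).trans (hx' i).symm)
  · intro s _
    refine (measurableSet_pk r (Fin k) hU).inter ?_
    refine measurableSet_forall fun i => ?_
    by_cases hi : i ∈ s
    · simp only [hi, true_iff]
      exact (measurable_pi_apply i) hB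
    · simp only [hi, false_iff]
      exact ((measurable_pi_apply (X := fun _ : Fin k => E) i) hB).compl

theorem measurable_vol_Tr (r : ℝ) {U B : Set E} (hU : MeasurableSet U) (hB : MeasurableSet B)
    (l m : ℕ) : Measurable fun w : Fin l → E => volume (pk r (Fin m) (Tr r U B w)) := by
  have : MeasurableSet {q : (Fin l → E) × (Fin m → E) | q.2 ∈ pk r (Fin m) (Tr r U B q.1)} := by
    have : {q : (Fin l → E) × (Fin m → E) | q.2 ∈ pk r (Fin m) (Tr r U B q.1)}
       = {q | q.2 ∈ pk r (Fin m) (U ∩ B)} ∩ {q | ∀ i, ∀ j, r < dist (q.2 i) (q.1 j)} := by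
      ext q
      simp only [pk, Tr, Set.mem_ofPred_eq, Set.mem_inter_iff]
      constructor
      · rintro ⟨h1, h2⟩
        exact ⟨⟨fun i => ⟨(h1 i).1, (h1 i).2.1⟩, h2⟩, fun i => (h1 i).2.2⟩
      · rintro ⟨⟨h1, h2⟩, h3⟩
        exact ⟨fun i => ⟨(h1 i).1, (h1 i).2, h3 i⟩, h2⟩
    rw [this]
    refine MeasurableSet.inter (measurable_snd (measurableSet_pk r (Fin m) (hU.inter hB))) ?_
    refine measurableSet_forall fun i => measurableSet_forall fun j => ?_
    exact measurableSet_lt measurable_const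
      (((measurable_pi_apply i).comp measurable_snd).dist
        ((measurable_pi_apply j).comp measurable_fst))
  exact measurable_measure_prodMk_left this

theorem cf_choose (t : ℝ≥0∞) (l m : ℕ) :
    cf t (m + l) * ((m + l).choose m : ℝ≥0∞) = cf t l * cf t m := by
  unfold cf
  have h := Nat.add_choose_mul_factorial_mul_factorial m l
  have h' : (((m + l).choose m : ℝ≥0∞)) * (m.factorial * l.factorial) = (m + l).factorial := by
    rw [← h, Nat.choose_symm_add]; push_cast; ring
  have hm : (m.factorial : ℝ≥0∞) ≠ 0 := by exact_mod_cast m.factorial_ne_zero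
  have hl : (l.factorial : ℝ≥0∞) ≠ 0 := by exact_mod_cast l.factorial_ne_zero
  have hc : (((m + l).choose m : ℝ≥0∞)) ≠ 0 := by
    exact_mod_cast (Nat.choose_pos (by omega)).ne'
  rw [← h']
  simp only [div_eq_mul_inv]
  rw [ENNReal.mul_inv (Or.inl hc) (Or.inl (ENNReal.natCast_ne_top _)),
    ENNReal.mul_inv (Or.inl hm) (Or.inl (ENNReal.natCast_ne_top _))]
  calc _ = t ^ (m + l) * ((m.factorial : ℝ≥0∞)⁻¹ * (l.factorial : ℝ≥0∞)⁻¹) *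
      ((((m + l).choose m : ℝ≥0∞))⁻¹ * ((m + l).choose m : ℝ≥0∞)) := by ring
    _ = _ := by
      rw [ENNReal.inv_mul_cancel hc (ENNReal.natCast_ne_top _), pow_add]; ring

theorem ZE_split (r : ℝ) (t : ℝ≥0∞) {U B : Set E} (hU : MeasurableSet U) (hB : MeasurableSet B) :
    ZE r t U = ∑' l : ℕ, cf t l * ∫⁻ w in pk r (Fin l) (U \ B), ZE r t (Tr r U B w) := by
  have h1 : ∀ l : ℕ, cf t l * ∫⁻ w in pk r (Fin l) (U \ B), ZE r t (Tr r U B w)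
      = ∑' m : ℕ, cf t l * cf t m * volume (Gs r U B l m) := by
    intro l
    unfold ZE
    rw [lintegral_tsum (fun m => ((measurable_vol_Tr r hU hB l m).const_mul _).aemeasurable),
      ← ENNReal.tsum_mul_left]
    congr 1
    ext m
    rw [lintegral_const_mul _ (measurable_vol_Tr r hU hB l m), vol_Gs r hU hB, mul_assoc]
  simp_rw [h1]
  rw [ENNReal.tsum_comm, ← ENNReal.tsum_prod,
    ← Finset.HasAntidiagonal.sigmaAntidiagonalEquivProd.tsum_eq, ENNReal.tsum_sigma']
  unfold ZE
  congr 1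
  ext k
  rw [vol_split r hU hB k, tsum_fintype, Finset.mul_sum, ← Finset.Nat.sum_antidiagonal_eq_sum_range_succ_mk (f := fun p : ℕ × ℕ => cf t k * ((k.choose p.1 : ℝ≥0∞) * volume (Gs r U B p.2 p.1)))]
  refine Eq.trans ?_ (Finset.sum_coe_sort (Finset.HasAntidiagonal.antidiagonal k) (fun p : ℕ × ℕ => cf t p.2 * cf t p.1 * volume (Gs r U B p.2 p.1))).symm
  refine Finset.sum_congr rfl fun p hp => ?_
  rw [Finset.HasAntidiagonal.mem_antidiagonal] at hp
  rw [← hp, ← mul_assoc, cf_choose]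


theorem measurable_ZE_Tr (r : ℝ) (t : ℝ≥0∞) {U B : Set E} (hU : MeasurableSet U)
    (hB : MeasurableSet B) (l : ℕ) :
    Measurable fun w : Fin l → E => ZE r t (Tr r U B w) := by
  unfold ZE
  exact Measurable.tsum fun m => (measurable_vol_Tr r hU hB l m).const_mul _

theorem far_eq_Tr (r : ℝ) (U : Set E) (u : E) :
    far r U u = Tr r U Set.univ (fun _ : Fin 1 => u) := by
  ext p; simp [far, Tr]

theorem far_eq_diff (r : ℝ) (U : Set E) (u : E) :
    far r U u = U \ Metric.closedBall u r := by
  ext p; simp [far]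

theorem far_Tr_eq (r : ℝ) (U B : Set E) {l : ℕ} (w : Fin l → E) (u : E) :
    far r (Tr r U B w) u = Tr r U B (Fin.cons u w : Fin (l + 1) → E) := by
  ext p
  simp only [far, Tr, Set.mem_ofPred_eq, Fin.forall_fin_succ, Fin.cons_zero, Fin.cons_succ]
  tauto

theorem measurable_ZE_far (r : ℝ) (t : ℝ≥0∞) {U : Set E} (hU : MeasurableSet U) :
    Measurable fun u : E => ZE r t (far r U u) := by
  simp_rw [far_eq_Tr]
  exact (measurable_ZE_Tr r t hU MeasurableSet.univ 1).comp
    (measurable_pi_lambda _ fun _ => measurable_id)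

theorem measurable_ZE_far_Tr (r : ℝ) (t : ℝ≥0∞) {U B : Set E} (hU : MeasurableSet U)
    (hB : MeasurableSet B) (l : ℕ) :
    Measurable fun q : (Fin l → E) × E => ZE r t (far r (Tr r U B q.1) q.2) := by
  simp_rw [far_Tr_eq]
  refine (measurable_ZE_Tr r t hU hB (l + 1)).comp
    (measurable_pi_lambda _ fun i => ?_)
  refine Fin.cases ?_ (fun j => ?_) i
  · simpa using measurable_snd
  · simp only [Fin.cons_succ]
    exact (measurable_pi_apply j).comp measurable_fst

theorem pk_mono (r : ℝ) (ι : Type) {U V : Set E} (h : U ⊆ V) : pk r ι U ⊆ pk r ι V :=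
  fun _ hx => ⟨fun i => h (hx.1 i), hx.2⟩

theorem vol_pk_le (r : ℝ) (k : ℕ) (U : Set E) :
    volume (pk r (Fin k) U) ≤ volume U ^ k := by
  calc volume (pk r (Fin k) U) ≤ volume (Set.univ.pi fun _ : Fin k => U) :=
        measure_mono fun x hx => by simpa using hx.1
    _ = _ := by rw [volume_pi_pi]; simp

theorem vol_pk_zero (r : ℝ) (U : Set E) : volume (pk r (Fin 0) U) = 1 := by
  have : pk r (Fin 0) U = Set.univ.pi fun _ : Fin 0 => U := by
    ext x; simp [pk]
  rw [this, volume_pi_pi]; simp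

theorem one_le_ZE (r : ℝ) (t : ℝ≥0∞) (U : Set E) : 1 ≤ ZE r t U := by
  unfold ZE
  refine le_trans ?_ (ENNReal.le_tsum 0)
  simp [cf, vol_pk_zero]

theorem cf_ofReal {a : ℝ} (ha : 0 ≤ a) (k : ℕ) :
    cf (ENNReal.ofReal a) k = ENNReal.ofReal (a ^ k / k.factorial) := by
  unfold cf
  rw [ENNReal.ofReal_div_of_pos (by positivity), ENNReal.ofReal_pow ha, ENNReal.ofReal_natCast]

theorem tsum_cf {a : ℝ} (ha : 0 ≤ a) :
    ∑' k, cf (ENNReal.ofReal a) k = ENNReal.ofReal (Real.exp a) := by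
  simp_rw [cf_ofReal ha]
  rw [← ENNReal.ofReal_tsum_of_nonneg (fun k => by positivity) (Real.summable_pow_div_factorial a),
    Real.exp_eq_exp_ℝ, NormedSpace.exp_eq_tsum_div]

theorem ZE_le (r : ℝ) {τ : ℝ} (hτ : 0 ≤ τ) {U : Set E} (hU : volume U ≠ ⊤) :
    ZE r (ENNReal.ofReal τ) U ≤ ENNReal.ofReal (Real.exp (τ * (volume U).toReal)) := by
  rw [← tsum_cf (by positivity)]
  unfold ZE
  refine ENNReal.tsum_le_tsum fun k => ?_
  refine (mul_le_mul_right (vol_pk_le r k U) _).trans (le_of_eq ?_)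
  unfold cf
  rw [ENNReal.ofReal_mul hτ, ENNReal.ofReal_toReal hU, mul_pow]
  simp only [div_eq_mul_inv]; ring

theorem ZE_far_le (r : ℝ) {τ : ℝ} (hτ : 0 ≤ τ) {U : Set E} (hU : MeasurableSet U)
    (hUf : volume U ≠ ⊤) (u : E) :
    ZE r (ENNReal.ofReal τ) U ≤
      ENNReal.ofReal (Real.exp (τ * (volume (U ∩ Metric.closedBall u r)).toReal)) *
        ZE r (ENNReal.ofReal τ) (far r U u) := by
  rw [ZE_split r _ hU (B := Metric.closedBall u r) measurableSet_closedBall, far_eq_diff]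
  set C := ENNReal.ofReal (Real.exp (τ * (volume (U ∩ Metric.closedBall u r)).toReal))
  have hf : volume (U ∩ Metric.closedBall u r) ≠ ⊤ :=
    ne_top_of_le_ne_top hUf (measure_mono Set.inter_subset_left)
  calc _ ≤ ∑' l : ℕ, cf (ENNReal.ofReal τ) l *
        ∫⁻ w in pk r (Fin l) (U \ Metric.closedBall u r), C := by
        refine ENNReal.tsum_le_tsum fun l => mul_le_mul_right (lintegral_mono fun w => ?_) _
        have hsub : Tr r U (Metric.closedBall u r) w ⊆ U ∩ Metric.closedBall u r :=
          fun p hp => ⟨hp.1, hp.2.1⟩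
        refine (ZE_le r hτ (ne_top_of_le_ne_top hf (measure_mono hsub))).trans ?_
        refine ENNReal.ofReal_le_ofReal (Real.exp_le_exp.2 ?_)
        exact mul_le_mul_of_nonneg_left (ENNReal.toReal_mono hf (measure_mono hsub)) hτ
    _ = _ := by
        unfold ZE
        rw [← ENNReal.tsum_mul_left]
        congr 1; ext l
        rw [setLIntegral_const]; ring

theorem ME_split (r : ℝ) (t : ℝ≥0∞) {U B : Set E} (hU : MeasurableSet U) (hB : MeasurableSet B) :
    t * ∫⁻ u in U ∩ B, ZE r t (far r U u) =
      ∑' l : ℕ, cf t l * ∫⁻ w in pk r (Fin l) (U \ B), ME r t (Tr r U B w) := by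
  have key : ∀ l (w : Fin l → E), ∫⁻ u in Tr r U B w, ZE r t (far r (Tr r U B w) u)
      = ∫⁻ u in U ∩ B, Set.indicator {q : (Fin l → E) × E | ∀ i, r < dist q.2 (q.1 i)}
        (fun q => ZE r t (far r (Tr r U B q.1) q.2)) (w, u) := by
    intro l w
    rw [← lintegral_indicator (measurable_Tr r hU hB w), ← lintegral_indicator (hU.inter hB)]
    congr 1
    ext u
    by_cases h1 : u ∈ U ∩ B
    · rw [Set.indicator_of_mem h1]
      by_cases h2 : ∀ i, r < dist u (w i)
      · rw [Set.indicator_of_mem (show u ∈ Tr r U B w from ⟨h1.1, h1.2, h2⟩),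
          Set.indicator_of_mem (by exact h2)]
      · rw [Set.indicator_of_notMem (show u ∉ Tr r U B w from fun h => h2 h.2.2),
          Set.indicator_of_notMem (by exact h2)]
    · rw [Set.indicator_of_notMem h1,
        Set.indicator_of_notMem (show u ∉ Tr r U B w from fun h => h1 ⟨h.1, h.2.1⟩)]
  have hm : ∀ l, Measurable (Set.indicator {q : (Fin l → E) × E | ∀ i, r < dist q.2 (q.1 i)}
        (fun q => ZE r t (far r (Tr r U B q.1) q.2))) := by
    intro l
    refine (measurable_ZE_far_Tr r t hU hB l).indicator ?_
    refine measurableSet_forall fun i => ?_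
    exact measurableSet_lt measurable_const
      (measurable_snd.dist ((measurable_pi_apply i).comp measurable_fst))
  have step : ∀ u ∈ U ∩ B, ZE r t (far r U u) = ∑' l : ℕ, cf t l *
      ∫⁻ w in pk r (Fin l) (U \ B),
        Set.indicator {q : (Fin l → E) × E | ∀ i, r < dist q.2 (q.1 i)}
        (fun q => ZE r t (far r (Tr r U B q.1) q.2)) (w, u) := by
    intro u _
    rw [ZE_split r t (measurable_far r hU u) hB]
    congr 1; ext l; congr 1
    rw [← lintegral_indicator (measurableSet_pk r _ ((measurable_far r hU u).diff hB)),
      ← lintegral_indicator (measurableSet_pk r _ (hU.diff hB))]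
    congr 1; ext w
    have hiff : w ∈ pk r (Fin l) (far r U u \ B) ↔
        w ∈ pk r (Fin l) (U \ B) ∧ ∀ i, r < dist u (w i) := by
      simp only [pk, far, Set.mem_ofPred_eq, Set.mem_sdiff]
      constructor
      · rintro ⟨h1, h2⟩
        exact ⟨⟨fun i => ⟨(h1 i).1.1, (h1 i).2⟩, h2⟩, fun i => by
          rw [dist_comm]; exact (h1 i).1.2⟩
      · rintro ⟨⟨h1, h2⟩, h3⟩
        exact ⟨fun i => ⟨⟨(h1 i).1, by rw [dist_comm]; exact h3 i⟩, (h1 i).2⟩, h2⟩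
    have hT : Tr r (far r U u) B w = far r (Tr r U B w) u := by
      ext p; simp only [Tr, far, Set.mem_ofPred_eq]; tauto
    by_cases h1 : w ∈ pk r (Fin l) (U \ B)
    · rw [Set.indicator_of_mem h1]
      by_cases h2 : ∀ i, r < dist u (w i)
      · rw [Set.indicator_of_mem (hiff.2 ⟨h1, h2⟩), Set.indicator_of_mem (by exact h2), hT]
      · rw [Set.indicator_of_notMem (fun h => h2 (hiff.1 h).2),
          Set.indicator_of_notMem (by exact h2)]
    · rw [Set.indicator_of_notMem h1, Set.indicator_of_notMem (fun h => h1 (hiff.1 h).1)]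
  rw [setLIntegral_congr_fun (hU.inter hB) step, lintegral_tsum, ← ENNReal.tsum_mul_left]
  · congr 1; ext l
    have hm2 : Measurable fun u : E => ∫⁻ w in pk r (Fin l) (U \ B),
        Set.indicator {q : (Fin l → E) × E | ∀ i, r < dist q.2 (q.1 i)}
        (fun q => ZE r t (far r (Tr r U B q.1) q.2)) (w, u) := (hm l).lintegral_prod_left'
    rw [lintegral_const_mul _ hm2, lintegral_lintegral_swap]
    · unfold ME
      simp_rw [key]
      rw [lintegral_const_mul _ (hm l).lintegral_prod_right']
      ring
    · exact ((hm l).comp measurable_swap).aemeasurable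
  · intro l
    exact ((hm l).lintegral_prod_left'.const_mul _).aemeasurable

theorem vol_pk_succ (r : ℝ) {U : Set E} (hU : MeasurableSet U) (k : ℕ) :
    volume (pk r (Fin (k + 1)) U) = ∫⁻ u in U, volume (pk r (Fin k) (far r U u)) := by
  have h := volume_preserving_piFinSuccAbove (fun _ : Fin (k + 1) => E) 0
  have hs := (MeasurePreserving.symm _ h)
  have hm := measurableSet_pk r (Fin (k + 1)) hU
  rw [← hs.measure_preimage hm.nullMeasurableSet, Measure.volume_eq_prod,
    Measure.prod_apply (hs.measurable hm), ← lintegral_indicator hU]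
  congr 1; ext u
  have hmem : ∀ y : Fin k → E, (MeasurableEquiv.piFinSuccAbove (fun _ : Fin (k + 1) => E) 0).symm
      (u, y) ∈ pk r (Fin (k + 1)) U ↔ u ∈ U ∧ y ∈ pk r (Fin k) (far r U u) := by
    intro y
    have e0 : (MeasurableEquiv.piFinSuccAbove (fun _ : Fin (k + 1) => E) 0).symm
      (u, y) = Fin.cons u y := by
      ext i; simp [MeasurableEquiv.piFinSuccAbove, Fin.insertNthEquiv]
    rw [e0]
    simp only [pk, far, Set.mem_ofPred_eq, Fin.forall_fin_succ, Fin.cons_zero, Fin.cons_succ,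
      ne_eq, not_true_eq_false, false_imp_iff, true_and, Fin.succ_inj]
    constructor
    · rintro ⟨⟨h1, h2⟩, h3, h4⟩
      exact ⟨h1, fun i => ⟨h2 i, (h4 i).1 (Fin.succ_ne_zero i)⟩, fun i => (h4 i).2⟩
    · rintro ⟨h1, h2, h3⟩
      exact ⟨⟨h1, fun i => (h2 i).1⟩, fun i _ => by rw [dist_comm]; exact (h2 i).2,
        fun i => ⟨fun _ => (h2 i).2, h3 i⟩⟩
  by_cases hu : u ∈ U
  · rw [Set.indicator_of_mem hu]
    congr 1; ext y
    simp only [Set.mem_preimage, hmem, hu, true_and]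
  · rw [Set.indicator_of_notMem hu]
    convert measure_empty (μ := (volume : Measure (Fin k → E)))
    ext y
    simp only [Set.mem_preimage, hmem, hu, false_and, Set.mem_empty_iff_false]

theorem measurable_vol_far (r : ℝ) {U : Set E} (hU : MeasurableSet U) (k : ℕ) :
    Measurable fun u : E => volume (pk r (Fin k) (far r U u)) := by
  simp_rw [far_eq_Tr]
  exact (measurable_vol_Tr r hU MeasurableSet.univ 1 k).comp
    (measurable_pi_lambda _ fun _ => measurable_id)

theorem ME_eq (r : ℝ) (t : ℝ≥0∞) {U : Set E} (hU : MeasurableSet U) :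
    ME r t U = ∑' k : ℕ, (k : ℝ≥0∞) * (cf t k * volume (pk r (Fin k) U)) := by
  rw [tsum_eq_zero_add' ENNReal.summable]
  simp only [Nat.cast_zero, zero_mul, zero_add]
  unfold ME ZE
  rw [lintegral_tsum (fun k => ((measurable_vol_far r hU k).const_mul _).aemeasurable),
    ← ENNReal.tsum_mul_left]
  congr 1; ext k
  rw [lintegral_const_mul _ (measurable_vol_far r hU k), vol_pk_succ r hU k]
  have : t * cf t k = ((k + 1 : ℕ) : ℝ≥0∞) * cf t (k + 1) := by
    unfold cf
    rw [Nat.factorial_succ]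
    have h1 : ((k + 1 : ℕ) : ℝ≥0∞) ≠ 0 := by exact_mod_cast Nat.succ_ne_zero k
    have h2 : ((k + 1 : ℕ) : ℝ≥0∞) ≠ ⊤ := ENNReal.natCast_ne_top _
    rw [Nat.cast_mul]
    simp only [div_eq_mul_inv]
    rw [ENNReal.mul_inv (Or.inl h1) (Or.inl h2)]
    calc _ = 1 * (t ^ (k + 1) * (k.factorial : ℝ≥0∞)⁻¹) := by ring
      _ = (((k + 1 : ℕ) : ℝ≥0∞) * ((k + 1 : ℕ) : ℝ≥0∞)⁻¹) *
        (t ^ (k + 1) * (k.factorial : ℝ≥0∞)⁻¹) := by rw [ENNReal.mul_inv_cancel h1 h2]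
      _ = _ := by ring
  rw [← mul_assoc, this, mul_assoc]


theorem ZE_mono (r : ℝ) (t : ℝ≥0∞) {U V : Set E} (h : U ⊆ V) : ZE r t U ≤ ZE r t V :=
  ENNReal.tsum_le_tsum fun _ => mul_le_mul_right (measure_mono (pk_mono r _ h)) _

theorem far_subset (r : ℝ) (U : Set E) (u : E) : far r U u ⊆ U := fun _ h => h.1

theorem ZE_ne_top (r : ℝ) {τ : ℝ} (hτ : 0 ≤ τ) {U : Set E} (hU : volume U ≠ ⊤) :
    ZE r (ENNReal.ofReal τ) U ≠ ⊤ :=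
  ne_top_of_le_ne_top ENNReal.ofReal_ne_top (ZE_le r hτ hU)

theorem int_far_ne_top (r : ℝ) {τ : ℝ} (hτ : 0 ≤ τ) {U : Set E} (hU : volume U ≠ ⊤) :
    ∫⁻ u in U, ZE r (ENNReal.ofReal τ) (far r U u) ≠ ⊤ := by
  refine ne_top_of_le_ne_top (b := ZE r (ENNReal.ofReal τ) U * volume U)
    (ENNReal.mul_ne_top (ZE_ne_top r hτ hU) hU) ?_
  rw [← setLIntegral_const]
  exact lintegral_mono fun u => ZE_mono r _ (far_subset r U u)

theorem ME_ne_top (r : ℝ) {τ : ℝ} (hτ : 0 ≤ τ) {U : Set E} (hU : volume U ≠ ⊤) :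
    ME r (ENNReal.ofReal τ) U ≠ ⊤ :=
  ENNReal.mul_ne_top ENNReal.ofReal_ne_top (int_far_ne_top r hτ hU)

theorem ZE_le_add (r : ℝ) {τ : ℝ} (hτ : 0 ≤ τ) {U : Set E} (hU : MeasurableSet U)
    (hUf : volume U ≠ ⊤) (u : E) :
    ZE r (ENNReal.ofReal τ) U ≤ ZE r (ENNReal.ofReal τ) (far r U u) +
      ENNReal.ofReal τ * ZE r (ENNReal.ofReal τ) U * volume (U ∩ Metric.closedBall u r) := by
  have h := ZE_far_le r hτ hU hUf u
  have hZ := ZE_ne_top r hτ hUf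
  have hF : ZE r (ENNReal.ofReal τ) (far r U u) ≠ ⊤ :=
    ne_top_of_le_ne_top hZ (ZE_mono r _ (far_subset r U u))
  have hB : volume (U ∩ Metric.closedBall u r) ≠ ⊤ :=
    ne_top_of_le_ne_top hUf (measure_mono Set.inter_subset_left)
  rw [← ENNReal.ofReal_toReal hZ, ← ENNReal.ofReal_toReal hF, ← ENNReal.ofReal_mul (by positivity),
    ENNReal.ofReal_le_ofReal_iff (by positivity)] at h
  rw [← ENNReal.ofReal_toReal hZ, ← ENNReal.ofReal_toReal hF, ← ENNReal.ofReal_toReal hB,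
    ← ENNReal.ofReal_mul hτ, ← ENNReal.ofReal_mul (by positivity),
    ← ENNReal.ofReal_add (by positivity) (by positivity)]
  apply ENNReal.ofReal_le_ofReal
  set q := (volume (U ∩ Metric.closedBall u r)).toReal
  set ζ := (ZE r (ENNReal.ofReal τ) U).toReal
  set f := (ZE r (ENNReal.ofReal τ) (far r U u)).toReal
  have hζ : 0 ≤ ζ := ENNReal.toReal_nonneg
  have h1 : Real.exp (-(τ * q)) * ζ ≤ f := by
    calc _ ≤ Real.exp (-(τ * q)) * (Real.exp (τ * q) * f) := by gcongr
      _ = f := by rw [← mul_assoc, ← Real.exp_add]; simp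
  have h2 := mul_le_mul_of_nonneg_right (Real.add_one_le_exp (-(τ * q))) hζ
  nlinarith

theorem star (r : ℝ) {τ G z : ℝ} (hτ : 0 ≤ τ) (hG : 0 ≤ G) (hτG : τ * G < 1) (hz : 0 ≤ z)
    {T : Set E} (hT : MeasurableSet T) (hTf : volume T ≠ ⊤)
    (hgeo : ∫⁻ u in T, volume (T ∩ Metric.closedBall u r) ≤ ENNReal.ofReal G * volume T) :
    ENNReal.ofReal (Real.exp (-z) * (1 + z)) * ZE r (ENNReal.ofReal τ) T ≤
      1 + ENNReal.ofReal (Real.exp (-z) / (1 - τ * G)) * ME r (ENNReal.ofReal τ) T := by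
  have hZ := ZE_ne_top r hτ hTf
  have hI := int_far_ne_top r hτ hTf
  have hle := ZE_le r hτ hTf
  have h1 : ZE r (ENNReal.ofReal τ) T * volume T ≤
      (∫⁻ u in T, ZE r (ENNReal.ofReal τ) (far r T u)) +
        ENNReal.ofReal τ * ZE r (ENNReal.ofReal τ) T * (ENNReal.ofReal G * volume T) := by
    calc _ = ∫⁻ u in T, ZE r (ENNReal.ofReal τ) T := by rw [setLIntegral_const]
      _ ≤ ∫⁻ u in T, (ZE r (ENNReal.ofReal τ) (far r T u) +
        ENNReal.ofReal τ * ZE r (ENNReal.ofReal τ) T * volume (T ∩ Metric.closedBall u r)) :=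
          lintegral_mono fun u => ZE_le_add r hτ hT hTf u
      _ = (∫⁻ u in T, ZE r (ENNReal.ofReal τ) (far r T u)) +
        ENNReal.ofReal τ * ZE r (ENNReal.ofReal τ) T *
          ∫⁻ u in T, volume (T ∩ Metric.closedBall u r) := by
          rw [lintegral_add_left (measurable_ZE_far r _ hT),
            lintegral_const_mul' _ _ (ENNReal.mul_ne_top ENNReal.ofReal_ne_top hZ)]
      _ ≤ _ := by gcongr
  unfold ME
  rw [← ENNReal.ofReal_toReal hZ, ← ENNReal.ofReal_toReal hI, ← ENNReal.ofReal_toReal hTf,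
    ← ENNReal.ofReal_mul (by positivity), ← ENNReal.ofReal_mul (by positivity),
    ← ENNReal.ofReal_mul (by positivity), ← ENNReal.ofReal_mul (by positivity),
    ← ENNReal.ofReal_add (by positivity) (by positivity),
    ENNReal.ofReal_le_ofReal_iff (by positivity)] at h1
  rw [← ENNReal.ofReal_toReal hZ, ENNReal.ofReal_le_ofReal_iff (by positivity)] at hle
  have h1G : 0 < 1 - τ * G := by linarith
  rw [← ENNReal.ofReal_toReal hZ, ← ENNReal.ofReal_toReal hI, ← ENNReal.ofReal_one,
    ← ENNReal.ofReal_mul (by positivity), ← ENNReal.ofReal_mul (by positivity),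
    ← ENNReal.ofReal_mul (by positivity),
    ← ENNReal.ofReal_add (by positivity) (by positivity)]
  apply ENNReal.ofReal_le_ofReal
  set ζ := (ZE r (ENNReal.ofReal τ) T).toReal
  set I := (∫⁻ u in T, ZE r (ENNReal.ofReal τ) (far r T u)).toReal
  set V := (volume T).toReal
  have hζ : 0 ≤ ζ := ENNReal.toReal_nonneg
  have h2 : τ * V * ζ ≤ τ * I / (1 - τ * G) := by
    rw [le_div_iff₀ h1G]
    have : ζ * V * (1 - τ * G) ≤ I := by linarith
    calc _ = τ * (ζ * V * (1 - τ * G)) := by ring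
      _ ≤ _ := by gcongr
  have h3 : Real.exp (-(τ * V)) * ζ ≤ 1 := by
    calc _ ≤ Real.exp (-(τ * V)) * Real.exp (τ * V) := by gcongr
      _ = 1 := by rw [← Real.exp_add]; simp
  have h4 : Real.exp (-z) * (1 + z - τ * V) ≤ Real.exp (-(τ * V)) := by
    have := Real.add_one_le_exp (z - τ * V)
    calc _ ≤ Real.exp (-z) * Real.exp (z - τ * V) := by gcongr; linarith
      _ = _ := by rw [← Real.exp_add]; ring_nf
  have h5 := mul_le_mul_of_nonneg_right h4 hζ
  have h6 := mul_le_mul_of_nonneg_left h2 (Real.exp_pos (-z)).le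
  have h7 : Real.exp (-z) / (1 - τ * G) * (τ * I) = Real.exp (-z) * (τ * I / (1 - τ * G)) := by
    ring
  rw [h7]
  nlinarith

theorem star_int (r : ℝ) {τ G z P : ℝ} (hτ : 0 ≤ τ) (hG : 0 ≤ G) (hτG : τ * G < 1) (hz : 0 ≤ z)
    (hP0 : 0 ≤ P) {S : Set E} (hS : MeasurableSet S) (hSf : volume S ≠ ⊤)
    (hP : ∀ v : E, volume (Metric.closedBall v r) ≤ ENNReal.ofReal P)
    (hgeo : ∀ v : E, ∀ T : Set E, MeasurableSet T → T ⊆ Metric.closedBall v r →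
      ∫⁻ u in T, volume (T ∩ Metric.closedBall u r) ≤ ENNReal.ofReal G * volume T) :
    ENNReal.ofReal (Real.exp (-z) * (1 + z)) * ZE r (ENNReal.ofReal τ) S * volume S ≤
      (∫⁻ v in S, ZE r (ENNReal.ofReal τ) (far r S v)) +
      ENNReal.ofReal (Real.exp (-z) / (1 - τ * G)) *
        (ENNReal.ofReal P * ME r (ENNReal.ofReal τ) S) := by
  set t := ENNReal.ofReal τ with ht
  set a := ENNReal.ofReal (Real.exp (-z) * (1 + z))
  set b := ENNReal.ofReal (Real.exp (-z) / (1 - τ * G))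
  have h1 : ∀ v : E, a * ZE r t S ≤ ZE r t (far r S v) +
      b * (t * ∫⁻ u in S ∩ Metric.closedBall v r, ZE r t (far r S u)) := by
    intro v
    rw [ME_split r t hS measurableSet_closedBall,
      ZE_split r t hS (measurableSet_closedBall (x := v) (ε := r)), far_eq_diff]
    conv_rhs => enter [1]; unfold ZE
    rw [← ENNReal.tsum_mul_left, ← ENNReal.tsum_mul_left, ← ENNReal.tsum_add]
    refine ENNReal.tsum_le_tsum fun l => ?_
    have h2 : ∫⁻ w in pk r (Fin l) (S \ Metric.closedBall v r),
        a * ZE r t (Tr r S (Metric.closedBall v r) w) ≤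
        ∫⁻ w in pk r (Fin l) (S \ Metric.closedBall v r),
          (1 + b * ME r t (Tr r S (Metric.closedBall v r) w)) := by
      refine lintegral_mono fun w => ?_
      have hsub : Tr r S (Metric.closedBall v r) w ⊆ Metric.closedBall v r := fun p hp => hp.2.1
      have hsub' : Tr r S (Metric.closedBall v r) w ⊆ S := fun p hp => hp.1
      have hTm := measurable_Tr r hS (measurableSet_closedBall (x := v) (ε := r)) w
      exact star r hτ hG hτG hz hTm (ne_top_of_le_ne_top hSf (measure_mono hsub'))
        (hgeo v _ hTm hsub)
    rw [lintegral_const_mul' _ _ ENNReal.ofReal_ne_top, lintegral_add_left measurable_const,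
      lintegral_const_mul' _ _ ENNReal.ofReal_ne_top, setLIntegral_const, one_mul] at h2
    calc _ = cf t l * (a * ∫⁻ w in pk r (Fin l) (S \ Metric.closedBall v r),
          ZE r t (Tr r S (Metric.closedBall v r) w)) := by ring
      _ ≤ _ := mul_le_mul_right h2 _
      _ = _ := by ring
  have hm := measurable_ZE_far r t hS
  have hmd : MeasurableSet {q : E × E | dist q.2 q.1 ≤ r} :=
    measurableSet_le (measurable_snd.dist measurable_fst) measurable_const
  have hmi : Measurable (Set.indicator {q : E × E | dist q.2 q.1 ≤ r}
      (fun q => ZE r t (far r S q.2))) := (hm.comp measurable_snd).indicator hmd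
  have h3 : ∀ v : E, ∫⁻ u in S ∩ Metric.closedBall v r, ZE r t (far r S u) =
      ∫⁻ u in S, Set.indicator {q : E × E | dist q.2 q.1 ≤ r}
      (fun q => ZE r t (far r S q.2)) (v, u) := by
    intro v
    rw [Set.inter_comm, ← Measure.restrict_restrict measurableSet_closedBall,
      ← lintegral_indicator measurableSet_closedBall]
    rfl
  have h4 : ∫⁻ v in S, ∫⁻ u in S ∩ Metric.closedBall v r, ZE r t (far r S u) ≤
      ENNReal.ofReal P * ∫⁻ u in S, ZE r t (far r S u) := by
    simp_rw [h3]
    rw [lintegral_lintegral_swap (f := fun v u => Set.indicator {q : E × E | dist q.2 q.1 ≤ r}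
      (fun q => ZE r t (far r S q.2)) (v, u)) hmi.aemeasurable,
      ← lintegral_const_mul' _ _ ENNReal.ofReal_ne_top]
    refine lintegral_mono fun u => ?_
    calc _ ≤ ∫⁻ v, Set.indicator (Metric.closedBall u r) (fun _ => ZE r t (far r S u)) v := by
          refine (setLIntegral_le_lintegral _ _).trans (lintegral_mono fun v => ?_)
          by_cases h : dist u v ≤ r
          · rw [Set.indicator_of_mem (by exact h), Set.indicator_of_mem
              (by rw [Metric.mem_closedBall, dist_comm]; exact h)]
          · rw [Set.indicator_of_notMem (by exact h)]
            exact zero_le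
      _ = ZE r t (far r S u) * volume (Metric.closedBall u r) := by
          rw [lintegral_indicator measurableSet_closedBall, setLIntegral_const]
      _ ≤ _ := by rw [mul_comm]; exact mul_le_mul_left (hP u) _
  calc _ = ∫⁻ v in S, a * ZE r t S := by rw [setLIntegral_const]
    _ ≤ ∫⁻ v in S, (ZE r t (far r S v) +
      b * (t * ∫⁻ u in S ∩ Metric.closedBall v r, ZE r t (far r S u))) :=
        lintegral_mono fun v => h1 v
    _ = (∫⁻ v in S, ZE r t (far r S v)) +
      b * (t * ∫⁻ v in S, ∫⁻ u in S ∩ Metric.closedBall v r, ZE r t (far r S u)) := by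
        rw [lintegral_add_left hm, lintegral_const_mul' _ _ ENNReal.ofReal_ne_top,
          lintegral_const_mul' _ _ ENNReal.ofReal_ne_top]
    _ ≤ (∫⁻ v in S, ZE r t (far r S v)) +
      b * (t * (ENNReal.ofReal P * ∫⁻ u in S, ZE r t (far r S u))) := by gcongr
    _ = _ := by unfold ME; ring

theorem density_bound (r : ℝ) {τ G z P : ℝ} (hτ : 0 ≤ τ) (hG : 0 ≤ G) (hτG : τ * G < 1)
    (hz : 0 ≤ z)
    (hP0 : 0 ≤ P) {S : Set E} (hS : MeasurableSet S) (hSf : volume S ≠ ⊤)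
    (hP : ∀ v : E, volume (Metric.closedBall v r) ≤ ENNReal.ofReal P)
    (hgeo : ∀ v : E, ∀ T : Set E, MeasurableSet T → T ⊆ Metric.closedBall v r →
      ∫⁻ u in T, volume (T ∩ Metric.closedBall u r) ≤ ENNReal.ofReal G * volume T) :
    τ * (1 + z) * (ZE r (ENNReal.ofReal τ) S).toReal * (volume S).toReal ≤
      (Real.exp z + τ * P / (1 - τ * G)) * (ME r (ENNReal.ofReal τ) S).toReal := by
  have h := star_int r hτ hG hτG hz hP0 hS hSf hP hgeo
  have hZ := ZE_ne_top r hτ hSf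
  have hI := int_far_ne_top r hτ hSf
  have h1G : 0 < 1 - τ * G := by linarith
  unfold ME at h ⊢
  rw [ENNReal.toReal_mul, ENNReal.toReal_ofReal hτ]
  rw [← ENNReal.ofReal_toReal hZ, ← ENNReal.ofReal_toReal hI, ← ENNReal.ofReal_toReal hSf,
    ← ENNReal.ofReal_mul (by positivity), ← ENNReal.ofReal_mul (by positivity),
    ← ENNReal.ofReal_mul (by positivity), ← ENNReal.ofReal_mul (by positivity),
    ← ENNReal.ofReal_mul (by positivity),
    ← ENNReal.ofReal_add (by positivity) (by positivity),
    ENNReal.ofReal_le_ofReal_iff (by positivity)] at h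
  set ζ := (ZE r (ENNReal.ofReal τ) S).toReal
  set I := (∫⁻ u in S, ZE r (ENNReal.ofReal τ) (far r S u)).toReal
  set V := (volume S).toReal
  have h2 := mul_le_mul_of_nonneg_left h (mul_nonneg hτ (Real.exp_pos z).le)
  have he : Real.exp z * Real.exp (-z) = 1 := by rw [← Real.exp_add]; simp
  calc _ = (Real.exp z * Real.exp (-z)) * (τ * (1 + z) * ζ * V) := by rw [he]; ring
    _ = τ * Real.exp z * (Real.exp (-z) * (1 + z) * ζ * V) := by ring
    _ ≤ _ := h2
    _ = τ * Real.exp z * I + (Real.exp z * Real.exp (-z)) * (τ * P / (1 - τ * G)) * (τ * I) := by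
      ring
    _ = _ := by rw [he]; ring

end HS
section Geo

theorem rd_pow (d : ℕ) (hd : 1 ≤ d) : ENNReal.ofReal (rd d ^ d) *
    volume (Metric.closedBall (0 : EuclideanSpace ℝ (Fin d)) 1) = 1 := by
  have hd' : (d : ℝ) ≠ 0 := by positivity
  have hpos : 0 < volume (Metric.closedBall (0 : EuclideanSpace ℝ (Fin d)) 1) :=
    Metric.measure_closedBall_pos _ _ one_pos
  have hfin : volume (Metric.closedBall (0 : EuclideanSpace ℝ (Fin d)) 1) ≠ ⊤ :=
    measure_closedBall_lt_top.ne
  have hV : 0 < (volume (Metric.closedBall (0 : EuclideanSpace ℝ (Fin d)) 1)).toReal :=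
    ENNReal.toReal_pos hpos.ne' hfin
  unfold rd
  rw [← Real.rpow_natCast, ← Real.rpow_mul hV.le]
  have : -(1 : ℝ) / d * d = -1 := by field_simp
  rw [this, Real.rpow_neg_one, ENNReal.ofReal_inv_of_pos hV, ENNReal.ofReal_toReal hfin]
  exact ENNReal.inv_mul_cancel hpos.ne' hfin

theorem rd_nonneg (d : ℕ) : 0 ≤ rd d := by unfold rd; positivity

theorem vol_cb (d : ℕ) (hd : 1 ≤ d) (x : EuclideanSpace ℝ (Fin d)) {s : ℝ} (hs : 0 ≤ s) :
    volume (Metric.closedBall x (s * rd d)) = ENNReal.ofReal (s ^ d) := by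
  have h := Measure.addHaar_closedBall_mul volume x (mul_nonneg hs (rd_nonneg d)) zero_le_one
  rw [mul_one, finrank_euclideanSpace_fin] at h
  rw [h, mul_pow, ENNReal.ofReal_mul (by positivity), mul_assoc, rd_pow d hd, mul_one]

theorem half_ball (d : ℕ) (hd : 1 ≤ d) (v u : EuclideanSpace ℝ (Fin d))
    (hu : dist u v ≤ 2 * rd d) :
    volume {w : EuclideanSpace ℝ (Fin d) | dist w u ≤ 2 * rd d ∧ dist w v ≤ dist u v} ≤
      ENNReal.ofReal (Real.sqrt 3 ^ d) := by
  rw [← vol_cb d hd ((1 / 2 : ℝ) • (u + v)) (Real.sqrt_nonneg 3)]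
  refine measure_mono fun w hw => ?_
  obtain ⟨h1, h2⟩ := hw
  rw [Metric.mem_closedBall]
  have hr := rd_nonneg d
  have h3 := parallelogram_law_with_norm ℝ (w - u) (w - v)
  have e1 : (w - u) - (w - v) = v - u := by abel
  have e2 : (w - u) + (w - v) = (2 : ℝ) • (w - (1 / 2 : ℝ) • (u + v)) := by
    rw [smul_sub, smul_smul, two_smul]; norm_num; abel
  rw [e1, e2, norm_smul, ← dist_eq_norm, ← dist_eq_norm, ← dist_eq_norm, ← dist_eq_norm,
    dist_comm v u] at h3
  norm_num at h3
  set D := dist w ((1 / 2 : ℝ) • (u + v)) with hD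
  norm_num at hD
  rw [← hD] at h3
  have hD0 : 0 ≤ D := dist_nonneg
  have hwu : 0 ≤ dist w u := dist_nonneg
  have hwv : 0 ≤ dist w v := dist_nonneg
  have huv : 0 ≤ dist u v := dist_nonneg
  apply le_of_sq_le_sq
  · rw [mul_pow, Real.sq_sqrt (by norm_num)]
    nlinarith
  · positivity

theorem geo (d : ℕ) (hd : 1 ≤ d) (v : EuclideanSpace ℝ (Fin d))
    (T : Set (EuclideanSpace ℝ (Fin d))) (hT : MeasurableSet T)
    (hTv : T ⊆ Metric.closedBall v (2 * rd d)) :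
    ∫⁻ u in T, volume (T ∩ Metric.closedBall u (2 * rd d)) ≤
      ENNReal.ofReal (2 * Real.sqrt 3 ^ d) * volume T := by
  set r := 2 * rd d with hr
  let D : Set (EuclideanSpace ℝ (Fin d) × EuclideanSpace ℝ (Fin d)) :=
    {q | dist q.2 q.1 ≤ r ∧ dist q.2 v ≤ dist q.1 v}
  have hD : MeasurableSet D :=
    (measurableSet_le (measurable_snd.dist measurable_fst) measurable_const).inter
    (measurableSet_le (measurable_snd.dist measurable_const) (measurable_fst.dist measurable_const))
  have hm : Measurable (D.indicator (fun _ => (1 : ℝ≥0∞))) := measurable_const.indicator hD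
  have h1 : ∀ u, volume (T ∩ Metric.closedBall u r) ≤
      (∫⁻ w in T, D.indicator (fun _ => (1 : ℝ≥0∞)) (u, w)) +
      ∫⁻ w in T, D.indicator (fun _ => (1 : ℝ≥0∞)) (w, u) := by
    intro u
    have hmu : Measurable fun w => D.indicator (fun _ => (1 : ℝ≥0∞)) (u, w) :=
      hm.comp measurable_prodMk_left
    rw [← lintegral_add_left hmu]
    rw [Set.inter_comm, ← Measure.restrict_apply measurableSet_closedBall,
      ← lintegral_indicator_one measurableSet_closedBall]
    refine lintegral_mono fun w => ?_
    by_cases hw : w ∈ Metric.closedBall u r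
    · rw [Set.indicator_of_mem hw]
      rw [Metric.mem_closedBall] at hw
      rcases le_total (dist w v) (dist u v) with h | h
      · rw [Set.indicator_of_mem (show (u, w) ∈ D from ⟨hw, h⟩)]
        exact le_self_add
      · rw [Set.indicator_of_mem (show (w, u) ∈ D from ⟨by rw [dist_comm]; exact hw, h⟩)]
        exact le_add_self
    · rw [Set.indicator_of_notMem hw]
      exact zero_le
  have h2 : ∫⁻ u in T, ∫⁻ w in T, D.indicator (fun _ => (1 : ℝ≥0∞)) (u, w) ≤
      ENNReal.ofReal (Real.sqrt 3 ^ d) * volume T := by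
    rw [← setLIntegral_const]
    refine setLIntegral_mono measurable_const fun u hu => ?_
    refine (setLIntegral_le_lintegral _ _).trans ?_
    refine le_trans (le_of_eq ?_) (half_ball d hd v u (hTv hu))
    rw [← lintegral_indicator_one]
    · rfl
    · exact measurable_prodMk_left hD
  calc _ ≤ ∫⁻ u in T, ((∫⁻ w in T, D.indicator (fun _ => (1 : ℝ≥0∞)) (u, w)) +
      ∫⁻ w in T, D.indicator (fun _ => (1 : ℝ≥0∞)) (w, u)) := lintegral_mono h1
    _ = (∫⁻ u in T, ∫⁻ w in T, D.indicator (fun _ => (1 : ℝ≥0∞)) (u, w)) +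
      ∫⁻ u in T, ∫⁻ w in T, D.indicator (fun _ => (1 : ℝ≥0∞)) (w, u) :=
        lintegral_add_left hm.lintegral_prod_right' _
    _ = (∫⁻ u in T, ∫⁻ w in T, D.indicator (fun _ => (1 : ℝ≥0∞)) (u, w)) +
      ∫⁻ u in T, ∫⁻ w in T, D.indicator (fun _ => (1 : ℝ≥0∞)) (u, w) := by
        congr 1
        exact lintegral_lintegral_swap
          (f := fun u w => D.indicator (fun _ => (1 : ℝ≥0∞)) (w, u))
          (hm.comp measurable_swap).aemeasurable
    _ ≤ _ := add_le_add h2 h2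
    _ = _ := by rw [ENNReal.ofReal_mul (by norm_num), ENNReal.ofReal_ofNat]; ring

theorem vol_Bn (d : ℕ) (hd : 1 ≤ d) {n : ℝ} (hn : 0 < n) :
    volume (Bn d n) = ENNReal.ofReal n := by
  unfold Bn
  rw [vol_cb d hd _ (by positivity), ← Real.rpow_natCast, ← Real.rpow_mul hn.le]
  have : (1 : ℝ) / d * d = 1 := by
    have : (d : ℝ) ≠ 0 := by positivity
    field_simp
  rw [this, Real.rpow_one]

end Geo

section Real

theorem Zhat_eq (d : ℕ) {S : Set (EuclideanSpace ℝ (Fin d))} (hS : MeasurableSet S) (k : ℕ) :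
    Zhat d S k = (1 / (k.factorial : ℝ)) * (volume (pk (2 * rd d) (Fin k) S)).toReal := by
  unfold Zhat
  congr 1
  have h : packSet d k S = pk (2 * rd d) (Fin k) S := rfl
  rw [h]
  exact integral_indicator_one (measurableSet_pk _ _ hS)

theorem Zhat_nonneg (d : ℕ) {S : Set (EuclideanSpace ℝ (Fin d))} (hS : MeasurableSet S) (k : ℕ) :
    0 ≤ Zhat d S k := by
  rw [Zhat_eq d hS]; positivity

theorem term_eq (d : ℕ) {S : Set (EuclideanSpace ℝ (Fin d))} (hS : MeasurableSet S) {τ : ℝ}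
    (hτ : 0 ≤ τ) (k : ℕ) :
    (cf (ENNReal.ofReal τ) k * volume (pk (2 * rd d) (Fin k) S)).toReal = τ ^ k * Zhat d S k := by
  rw [Zhat_eq d hS, ENNReal.toReal_mul, cf_ofReal hτ, ENNReal.toReal_ofReal (by positivity)]
  ring

theorem hasSum_Z (d : ℕ) {S : Set (EuclideanSpace ℝ (Fin d))} (hS : MeasurableSet S)
    (hSf : volume S ≠ ⊤) {τ : ℝ} (hτ : 0 ≤ τ) :
    HasSum (fun k => τ ^ k * Zhat d S k) (ZE (2 * rd d) (ENNReal.ofReal τ) S).toReal := by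
  have h : ∑' k, cf (ENNReal.ofReal τ) k * volume (pk (2 * rd d) (Fin k) S) ≠ ⊤ :=
    ZE_ne_top _ hτ hSf
  have h1 := ENNReal.hasSum_toReal h
  simp_rw [term_eq d hS hτ] at h1
  convert h1 using 1
  unfold ZE
  rw [ENNReal.tsum_toReal_eq (ENNReal.ne_top_of_tsum_ne_top h)]
  simp_rw [term_eq d hS hτ]

theorem hasSum_M (d : ℕ) {S : Set (EuclideanSpace ℝ (Fin d))} (hS : MeasurableSet S)
    (hSf : volume S ≠ ⊤) {τ : ℝ} (hτ : 0 ≤ τ) :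
    HasSum (fun k : ℕ => (k : ℝ) * (τ ^ k * Zhat d S k))
      (ME (2 * rd d) (ENNReal.ofReal τ) S).toReal := by
  have h : ∑' k : ℕ, (k : ℝ≥0∞) * (cf (ENNReal.ofReal τ) k * volume (pk (2 * rd d) (Fin k) S)) ≠ ⊤ := by
    rw [← ME_eq _ _ hS]
    exact ME_ne_top _ hτ hSf
  have h1 := ENNReal.hasSum_toReal h
  rw [← ENNReal.tsum_toReal_eq (ENNReal.ne_top_of_tsum_ne_top h), ← ME_eq _ _ hS] at h1
  simpa only [ENNReal.toReal_mul (a := ((_ : ℕ) : ℝ≥0∞)), term_eq d hS hτ,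
    ENNReal.toReal_natCast] using h1

theorem Zgc_eq (d : ℕ) {S : Set (EuclideanSpace ℝ (Fin d))} (hS : MeasurableSet S)
    (hSf : volume S ≠ ⊤) {τ : ℝ} (hτ : 0 ≤ τ) :
    Zgc d S τ = (ZE (2 * rd d) (ENNReal.ofReal τ) S).toReal := (hasSum_Z d hS hSf hτ).tsum_eq

theorem one_le_Zgc (d : ℕ) {S : Set (EuclideanSpace ℝ (Fin d))} (hS : MeasurableSet S)
    (hSf : volume S ≠ ⊤) {τ : ℝ} (hτ : 0 ≤ τ) : 1 ≤ Zgc d S τ := by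
  rw [Zgc_eq d hS hSf hτ, ← ENNReal.toReal_one]
  exact ENNReal.toReal_mono (ZE_ne_top _ hτ hSf) (one_le_ZE _ _ _)

theorem Zgc_le (d : ℕ) {S : Set (EuclideanSpace ℝ (Fin d))} (hS : MeasurableSet S)
    (hSf : volume S ≠ ⊤) {τ : ℝ} (hτ : 0 ≤ τ) :
    Zgc d S τ ≤ Real.exp (τ * (volume S).toReal) := by
  rw [Zgc_eq d hS hSf hτ]
  exact ENNReal.toReal_le_of_le_ofReal (by positivity) (ZE_le _ hτ hSf)

theorem log_step (d : ℕ) {S : Set (EuclideanSpace ℝ (Fin d))} (hS : MeasurableSet S)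
    (hSf : volume S ≠ ⊤) {τ h A : ℝ} (hτ : 0 < τ) (hh : 0 ≤ h)
    (hA : A * Zgc d S τ ≤ (ME (2 * rd d) (ENNReal.ofReal τ) S).toReal) :
    Real.log (Zgc d S τ) + h * A ≤ Real.log (Zgc d S (τ * Real.exp h)) := by
  have hZ1 := one_le_Zgc d hS hSf hτ.le
  have s1 := hasSum_Z d hS hSf hτ.le
  have s2 := hasSum_M d hS hSf hτ.le
  have s3 := hasSum_Z d hS hSf (mul_nonneg hτ.le (Real.exp_pos h).le)
  rw [← Zgc_eq d hS hSf hτ.le] at s1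
  rw [← Zgc_eq d hS hSf (mul_nonneg hτ.le (Real.exp_pos h).le)] at s3
  set Z := Zgc d S τ
  set M := (ME (2 * rd d) (ENNReal.ofReal τ) S).toReal
  set θ := h * A
  have s4 := ((s1.mul_left (1 - θ)).add (s2.mul_left h)).mul_left (Real.exp θ)
  have hle := hasSum_le (fun k => ?_) s4 s3
  · have h2 : Real.exp θ * Z ≤ Zgc d S (τ * Real.exp h) := by
      refine le_trans ?_ hle
      gcongr
      have := mul_le_mul_of_nonneg_left hA hh
      simp only [θ]
      nlinarith
    have h3 := Real.log_le_log (by positivity) h2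
    rw [Real.log_mul (Real.exp_pos _).ne' (by positivity), Real.log_exp] at h3
    linarith
  · have hz := Zhat_nonneg d hS k
    have h1 := Real.add_one_le_exp (k * h - θ)
    have h2 : Real.exp θ * (1 - θ + k * h) ≤ Real.exp (k * h) := by
      calc _ ≤ Real.exp θ * Real.exp (k * h - θ) := by gcongr; linarith
        _ = _ := by rw [← Real.exp_add]; ring_nf
    have h3 : 0 ≤ τ ^ k * Zhat d S k := by positivity
    calc _ = (Real.exp θ * (1 - θ + k * h)) * (τ ^ k * Zhat d S k) := by ring
      _ ≤ Real.exp (k * h) * (τ ^ k * Zhat d S k) := by gcongr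
      _ = _ := by rw [mul_pow, ← Real.exp_nat_mul]; ring

theorem density (d : ℕ) (hd : 1 ≤ d) {n τ z : ℝ} (hn : 0 < n) (hτ : 0 < τ) (hz : 0 ≤ z)
    (hG : τ * (2 * Real.sqrt 3 ^ d) < 1) :
    τ * (1 + z) * Zgc d (Bn d n) τ * n ≤
      (Real.exp z + τ * 2 ^ d / (1 - τ * (2 * Real.sqrt 3 ^ d))) *
        (ME (2 * rd d) (ENNReal.ofReal τ) (Bn d n)).toReal := by
  have hS : MeasurableSet (Bn d n) := measurableSet_closedBall
  have hv := vol_Bn d hd hn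
  have hSf : volume (Bn d n) ≠ ⊤ := by rw [hv]; exact ENNReal.ofReal_ne_top
  have := density_bound (2 * rd d) hτ.le (by positivity) hG hz (P := 2 ^ d) (by positivity) hS hSf
    (fun v => (vol_cb d hd v (by norm_num)).le) (geo d hd)
  rwa [← Zgc_eq d hS hSf hτ.le, hv, ENNReal.toReal_ofReal hn.le] at this

theorem ev_cond {η : ℝ} (hη : 0 < η) : ∃ d₀ : ℕ, ∀ d : ℕ, d₀ ≤ d → 1 ≤ d ∧
    Real.log d ≤ η / 2 * d ∧ 2 * Real.exp (-(η * d)) < 1 ∧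
    1 / (d : ℝ) + 1 / (1 - 2 * Real.exp (-(η * d))) ≤ 1 + η / 2 := by
  have hc : Tendsto (fun d : ℕ => (d : ℝ)) atTop atTop := tendsto_natCast_atTop_atTop
  have h1 : ∀ᶠ d : ℕ in atTop, 1 ≤ d := eventually_ge_atTop 1
  have h2 : ∀ᶠ d : ℕ in atTop, Real.log d ≤ η / 2 * d := by
    have := (Real.isLittleO_log_id_atTop.def (half_pos hη))
    filter_upwards [hc.eventually this] with d hd
    simp only [id, Real.norm_eq_abs, Nat.abs_cast] at hd
    exact (le_abs_self _).trans hd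
  have hexp : Tendsto (fun d : ℕ => 2 * Real.exp (-(η * d))) atTop (nhds 0) := by
    have : Tendsto (fun d : ℕ => Real.exp (-(η * d))) atTop (nhds 0) :=
      Real.tendsto_exp_atBot.comp (tendsto_neg_atTop_atBot.comp (hc.const_mul_atTop hη))
    simpa using this.const_mul 2
  have h3 : ∀ᶠ d : ℕ in atTop, 2 * Real.exp (-(η * d)) < 1 := hexp.eventually_lt_const one_pos
  have hlim : Tendsto (fun d : ℕ => 1 / (d : ℝ) + 1 / (1 - 2 * Real.exp (-(η * d)))) atTop
      (nhds (0 + 1 / (1 - 0))) := by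
    refine Tendsto.add tendsto_one_div_atTop_nhds_zero_nat ?_
    exact tendsto_const_nhds.div (tendsto_const_nhds.sub hexp) (by norm_num)
  have h4 : ∀ᶠ d : ℕ in atTop, 1 / (d : ℝ) + 1 / (1 - 2 * Real.exp (-(η * d))) ≤ 1 + η / 2 := by
    refine hlim.eventually_le_const ?_
    norm_num; exact hη
  exact eventually_atTop.1 (h1.and (h2.and (h3.and h4)))

theorem density_asymp {η : ℝ} (hη : 0 < η) : ∃ d₀ : ℕ, ∀ d : ℕ, d₀ ≤ d → 1 ≤ d ∧
    ∀ x : ℝ, Real.log 3 / 2 + η ≤ x → ∀ n : ℝ, 0 < n →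
      (n * (d / 2 ^ d) * (Real.log 2 - x - η)) * Zgc d (Bn d n) (Real.exp (-(x * d))) ≤
        (ME (2 * rd d) (ENNReal.ofReal (Real.exp (-(x * d)))) (Bn d n)).toReal := by
  obtain ⟨d₀, h₀⟩ := ev_cond hη
  refine ⟨d₀, fun d hd => ?_⟩
  obtain ⟨hd1, hlog, hex, hk⟩ := h₀ d hd
  refine ⟨hd1, fun x hx n hn => ?_⟩
  have hS : MeasurableSet (Bn d n) := measurableSet_closedBall
  have hSf : volume (Bn d n) ≠ ⊤ := by rw [vol_Bn d hd1 hn]; exact ENNReal.ofReal_ne_top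
  have hdpos : (0 : ℝ) < d := by positivity
  set τ := Real.exp (-(x * d)) with hτdef
  have hτ : 0 < τ := Real.exp_pos _
  have hZ1 := one_le_Zgc d hS hSf hτ.le
  set Z := Zgc d (Bn d n) τ
  set y := Real.log 2 - x with hy
  have hM0 : 0 ≤ (ME (2 * rd d) (ENNReal.ofReal τ) (Bn d n)).toReal := ENNReal.toReal_nonneg
  by_cases hyη : y - η ≤ 0
  · refine le_trans ?_ hM0
    have : 0 ≤ n * (d / 2 ^ d) * Z := by positivity
    nlinarith
  push Not at hyη
  have hl3 : 0 < Real.log 3 := Real.log_pos (by norm_num)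
  have hl2 : Real.log 2 < 1 := by linarith [Real.log_two_lt_d9]
  have hy1 : y ≤ 1 := by rw [hy]; linarith
  set z := y * d - Real.log d with hz
  have hz0 : 0 ≤ z := by rw [hz]; nlinarith
  have hsq : Real.sqrt 3 ^ d = Real.exp (Real.log 3 / 2 * d) := by
    rw [← Real.exp_log (show (0 : ℝ) < Real.sqrt 3 by positivity), ← Real.exp_nat_mul,
      Real.log_sqrt (by norm_num)]
    ring_nf
  have hG : τ * (2 * Real.sqrt 3 ^ d) ≤ 2 * Real.exp (-(η * d)) := by
    calc _ = 2 * (τ * Real.sqrt 3 ^ d) := by ring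
      _ ≤ _ := by
        rw [hsq, hτdef, ← Real.exp_add]
        gcongr
        nlinarith
  have hez : Real.exp z = τ * 2 ^ d / d := by
    have h2 : (2 : ℝ) ^ d = Real.exp (d * Real.log 2) := by
      rw [Real.exp_nat_mul, Real.exp_log (by norm_num)]
    rw [hz, Real.exp_sub, Real.exp_log hdpos, h2, hτdef, ← Real.exp_add, hy]
    ring_nf
  have hden := density d hd1 hn hτ hz0 (lt_of_le_of_lt hG hex)
  set M := (ME (2 * rd d) (ENNReal.ofReal τ) (Bn d n)).toReal
  have hk2 : 1 / (1 - τ * (2 * Real.sqrt 3 ^ d)) ≤ 1 / (1 - 2 * Real.exp (-(η * d))) := by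
    apply one_div_le_one_div_of_le <;> linarith
  have h1 : (1 + z) * Z * n ≤ 2 ^ d * (1 + η / 2) * M := by
    have e1 : Real.exp z + τ * 2 ^ d / (1 - τ * (2 * Real.sqrt 3 ^ d)) =
      τ * (2 ^ d * (1 / d + 1 / (1 - τ * (2 * Real.sqrt 3 ^ d)))) := by rw [hez]; ring
    rw [e1] at hden
    have h2 : (1 + z) * Z * n ≤ 2 ^ d * (1 / d + 1 / (1 - τ * (2 * Real.sqrt 3 ^ d))) * M := by
      refine le_of_mul_le_mul_left ?_ hτ
      calc _ = τ * (1 + z) * Z * n := by ring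
        _ ≤ _ := hden
        _ = _ := by ring
    refine h2.trans ?_
    exact mul_le_mul_of_nonneg_right (mul_le_mul_of_nonneg_left (by linarith) (by positivity)) hM0
  have h2 : (1 + η / 2) * (d * (y - η)) ≤ 1 + z := by
    rw [hz]
    have h3 : (1 + η / 2) * (y - η) ≤ y - η / 2 := by nlinarith
    have h4 := mul_le_mul_of_nonneg_right h3 hdpos.le
    nlinarith
  have h5 : (1 + η / 2) * (d * (y - η)) * (Z * n) ≤ (1 + z) * (Z * n) := by gcongr
  have hpos : (0 : ℝ) < 2 ^ d * (1 + η / 2) := by positivity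
  refine le_of_mul_le_mul_left ?_ hpos
  calc _ = (1 + η / 2) * (d * (y - η)) * (Z * n) := by field_simp
    _ ≤ (1 + z) * (Z * n) := h5
    _ = (1 + z) * Z * n := by ring
    _ ≤ _ := h1

theorem sum_aux (K : ℝ) (m : ℕ) :
    ∑ i ∈ Finset.range m, (K - i - 2) = m * K - m * (m - 1) / 2 - 2 * m := by
  induction m with
  | zero => simp
  | succ m ih => rw [Finset.sum_range_succ, ih]; push_cast; ring

end Real

/-- lower bound on the pressure of the hard sphere model:
for `log 3 / 2 ≤ c < log 2` and `λ = e^{-cd}`,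
`g_d(λ) ≥ ((log 2 - c)²/2 + o_d(1)) d² 2^{-d}`. -/
theorem hard_sphere_pressure_lower_bound :
    ∀ c : ℝ, Real.log 3 / 2 ≤ c → c < Real.log 2 →
    ∀ ε : ℝ, 0 < ε → ∃ d₀ : ℕ, ∀ d : ℕ, d₀ ≤ d →
      Filter.liminf
          (fun n : ℝ => (1 / n) * Real.log (Zgc d (Bn d n) (Real.exp (-(c * d)))))
          Filter.atTop
        ≥ ((Real.log 2 - c) ^ 2 / 2 - ε) * d ^ 2 / 2 ^ d := by
  intro c hc3 hc2 ε hε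
  set L := Real.log 2 - c with hL
  have hL0 : 0 < L := by rw [hL]; linarith
  obtain ⟨K, hK⟩ := exists_nat_gt (3 * L ^ 2 / (2 * ε))
  have hK0 : (0 : ℝ) < K := lt_of_le_of_lt (by positivity) hK
  have hη : 0 < L / K := by positivity
  obtain ⟨d₀, h₀⟩ := density_asymp hη
  refine ⟨d₀, fun d hd => ?_⟩
  obtain ⟨hd1, hden⟩ := h₀ d hd
  have hS : ∀ n : ℝ, MeasurableSet (Bn d n) := fun n => measurableSet_closedBall
  have hSf : ∀ n : ℝ, 0 < n → volume (Bn d n) ≠ ⊤ := fun n hn => by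
    rw [vol_Bn d hd1 hn]; exact ENNReal.ofReal_ne_top
  apply Filter.le_liminf_of_le
  · refine Filter.IsCoboundedUnder.of_frequently_le (a := Real.exp (-(c * d))) ?_
    refine (Filter.Eventually.frequently ?_)
    filter_upwards [eventually_gt_atTop (0 : ℝ)] with n hn
    have h1 := Zgc_le d (hS n) (hSf n hn) (Real.exp_pos (-(c * d))).le
    have h2 := one_le_Zgc d (hS n) (hSf n hn) (Real.exp_pos (-(c * d))).le
    have h3 := Real.log_le_log (by linarith) h1
    rw [Real.log_exp, vol_Bn d hd1 hn, ENNReal.toReal_ofReal hn.le] at h3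
    rw [one_div, inv_mul_le_iff₀ hn]
    linarith
  · filter_upwards [eventually_gt_atTop (0 : ℝ)] with n hn
    let f : ℕ → ℝ := fun i => Real.log (Zgc d (Bn d n) (Real.exp (-((c + i * (L / K)) * d))))
    have hstep : ∀ i ∈ Finset.range K,
        (n * (d ^ 2 / 2 ^ d) * (L / K) ^ 2) * ((K : ℝ) - i - 2) ≤ f i - f (i + 1) := by
      intro i _
      have hi0 : (0 : ℝ) ≤ i := by positivity
      have hx : Real.log 3 / 2 + L / K ≤ c + ((i + 1 : ℕ) : ℝ) * (L / K) := by
        push_cast; nlinarith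
      have h1 := hden _ hx n hn
      have h2 := log_step d (hS n) (hSf n hn) (Real.exp_pos _)
        (show 0 ≤ L / K * d by positivity) h1
      rw [← Real.exp_add] at h2
      have e1 : -((c + ((i + 1 : ℕ) : ℝ) * (L / K)) * d) + L / K * d
          = -((c + i * (L / K)) * d) := by push_cast; ring
      rw [e1] at h2
      have e2 : L / K * d * (n * (d / 2 ^ d) *
          (Real.log 2 - (c + ((i + 1 : ℕ) : ℝ) * (L / K)) - L / K)) =
          (n * (d ^ 2 / 2 ^ d) * (L / K) ^ 2) * ((K : ℝ) - i - 2) := by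
        have : Real.log 2 = L + c := by rw [hL]; ring
        rw [this]
        push_cast
        field_simp
        ring
      rw [e2] at h2
      simp only [f]
      linarith
    have hsum := Finset.sum_le_sum hstep
    rw [← Finset.mul_sum, sum_aux, Finset.sum_range_sub'] at hsum
    have hfK : 0 ≤ f K := Real.log_nonneg (one_le_Zgc d (hS n) (hSf n hn) (Real.exp_pos _).le)
    have hf0 : f 0 = Real.log (Zgc d (Bn d n) (Real.exp (-(c * d)))) := by simp [f]
    rw [← hf0, one_div, le_inv_mul_iff₀ hn]
    refine le_trans ?_ (le_trans hsum (by linarith))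
    have e3 : (n * (d ^ 2 / 2 ^ d) * (L / K) ^ 2) * ((K : ℝ) * K - K * (K - 1) / 2 - 2 * K) =
        n * (d ^ 2 / 2 ^ d) * (L ^ 2 / 2 - 3 * L ^ 2 / (2 * K)) := by
      field_simp
      ring
    rw [e3]
    have h5 : 3 * L ^ 2 / (2 * K) ≤ ε := by
      rw [div_lt_iff₀ (by positivity)] at hK
      rw [div_le_iff₀ (by positivity)]
      nlinarith
    calc _ = n * (d ^ 2 / 2 ^ d) * (L ^ 2 / 2 - ε) := by ring
      _ ≤ _ := by gcongr
end
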